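/- Assume the standing hypotheses. Then: (a) there exists a constant C ≥ 0 such that for every integer n ≤ 0, every 0 ≤ k ≤ d and every m ∈ ℤ≥0^J with r − (|k|+|m|) > 0, the function 1_{F∖D(0,n+1)}(z) z^k z^m belongs to B(χ,J,d) and ‖1_{F∖D(0,n+1)}(z) z^k z^m‖_B ≤ C q^{n(r−|k|−|m|)}; (b) there exists a constant C ≥ 0 such that for every a ∈ F, every integer n ≥ 1, every 0 ≤ k ≤ d and every m ∈ ℤ≥0^J with r − (|k|+|m|) > 0, the function 1_{D(a,n)}(z) χ2χ1^{−1}(z−a)(z−a)^{d−k}(z−a)^{−m} belongs to B(χ,J,d) and ‖1_{D(a,n)}(z) χ2χ1^{−1}(z−a)(z−a)^{d−k}(z−a)^{−m}‖_B ≤ C q^{n(|k|+|m|−r)}. -/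

import Mathlib

/- Preamble: formalization of the basic objects from "Fonctions de classe C^r sur O_F"
   (C^r functions on O_F, locally analytic functions, locally J-analytic characters,
   the spaces V(χ,J,d), B(χ,J,d), the lattice Λ, etc.).

   Conventions:
   * F, E are nonarchimedean complete normed fields (abstracting finite extensions of ℚ_p);
   * O_F is encoded by the predicate ‖·‖ ≤ 1, and functions on O_F are encoded as
     functions on F whose defining conditions only quantify over the unit ball;
   * `q` is the residue cardinality, `ϖ` a uniformizer with ‖ϖ‖ = q⁻¹,
     and D(a,n) = {z : ‖z - a‖ ≤ q^(-n)};
   * S is the (finite) set of embeddings F → E, `emb σ` the corresponding ring maps;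
   * multi-indices are functions `i : S → ℕ`; a pair (k over S∖J, m over J) is encoded
     as the single multi-index agreeing with k off J and with m on J. -/

open scoped Classical Topology
open Filter

noncomputable section

namespace Paper

variable {F E : Type*} [NormedField F] [NormedField E]
variable {S : Type*} [Fintype S]

/-- total degree |i| of a multi-index -/
def mSum (i : S → ℕ) : ℕ := ∑ σ, i σ

/-- i! -/
def mFact (i : S → ℕ) : ℕ := ∏ σ, (i σ).factorial

/-- z^i = ∏_σ σ(z)^(i_σ) -/
def mPow (emb : S → (F →+* E)) (z : F) (i : S → ℕ) : E := ∏ σ, (emb σ z) ^ (i σ)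

/-- the (finite) set of multi-indices of total degree ≤ N -/
def degLE (S : Type*) [Fintype S] (N : ℕ) : Finset (S → ℕ) :=
  ((Finset.univ : Finset (S → Fin (N + 1))).image (fun i σ => (i σ : ℕ))).filter
    (fun i => mSum i ≤ N)

/-- the remainder ε_{f,N}(x,y) = f(x+y) - Σ_{|i| ≤ N} D_i f(x) y^i / i! -/
def crRem (emb : S → (F →+* E)) (N : ℕ) (f : F → E) (Df : (S → ℕ) → F → E)
    (x y : F) : E :=
  f (x + y) - ∑ i ∈ degLE S N, Df i x * mPow emb y i / (mFact i : E)

/-- `f` is of class C^r on O_F with derivative data `Df`: the `Df i` (|i| ≤ ⌊r⌋) are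
bounded on O_F and C_{f,r}(h) = sup_{x ∈ O_F, y ∈ ϖ^h O_F} |ε_{f,[r]}(x,y)| q^{rh} → 0. -/
def IsCrWith (q : ℕ) (emb : S → (F →+* E)) (r : ℝ) (f : F → E)
    (Df : (S → ℕ) → F → E) : Prop :=
  (∀ i : S → ℕ, mSum i ≤ ⌊r⌋₊ → ∃ C : ℝ, ∀ x : F, ‖x‖ ≤ 1 → ‖Df i x‖ ≤ C) ∧
  ∀ ε : ℝ, 0 < ε → ∃ H : ℕ, ∀ h : ℕ, H ≤ h → ∀ x y : F, ‖x‖ ≤ 1 →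
    ‖y‖ ≤ (q : ℝ) ^ (-(h : ℤ)) →
      ‖crRem emb ⌊r⌋₊ f Df x y‖ * (q : ℝ) ^ (r * (h : ℝ)) ≤ ε

/-- `f` is of class C^r on O_F -/
def IsCr (q : ℕ) (emb : S → (F →+* E)) (r : ℝ) (f : F → E) : Prop :=
  ∃ Df, IsCrWith q emb r f Df

/-- the C^r norm computed from derivative data `Df` -/
def crNormWith (emb : S → (F →+* E)) (r : ℝ) (f : F → E)
    (Df : (S → ℕ) → F → E) : ℝ :=
  sSup ({x | ∃ i : S → ℕ, mSum i ≤ ⌊r⌋₊ ∧ ∃ z : F, ‖z‖ ≤ 1 ∧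
          x = ‖Df i z / (mFact i : E)‖} ∪
        {x | ∃ z y : F, ‖z‖ ≤ 1 ∧ ‖y‖ ≤ 1 ∧ y ≠ 0 ∧
          x = ‖crRem emb ⌊r⌋₊ f Df z y‖ / ‖y‖ ^ r})

/-- the C^r norm of `f` (the derivative data being unique, the set below is a singleton
when `f` is of class C^r). -/
def crNorm (q : ℕ) (emb : S → (F →+* E)) (r : ℝ) (f : F → E) : ℝ :=
  sSup {c | ∃ Df, IsCrWith q emb r f Df ∧ c = crNormWith emb r f Df}

/-- membership in the closed subspace C^r(O_F, J, d) of C^r(O_F, E):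
∂^{dσ+1} f / ∂z_σ^{dσ+1} = 0 for σ ∉ J. -/
def IsCrJ (q : ℕ) (emb : S → (F →+* E)) (r : ℝ) (J : Set S) (d : S → ℕ)
    (f : F → E) : Prop :=
  ∃ Df, IsCrWith q emb r f Df ∧
    ∀ σ : S, σ ∉ J → ∀ x : F, ‖x‖ ≤ 1 → Df (Pi.single σ (d σ + 1)) x = 0

/-- `c` is the family of Taylor coefficients of an expansion of `f` on D(a,h), with
exponents bounded by `d` off `J`, and coefficients with ‖c m‖ q^{-h|m|} → 0. -/
def IsExpansionAt (q : ℕ) (emb : S → (F →+* E)) (J : Set S) (d : S → ℕ) (h : ℕ)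
    (a : F) (c : (S → ℕ) → E) (f : F → E) : Prop :=
  (∀ m : S → ℕ, ¬ (∀ σ, σ ∉ J → m σ ≤ d σ) → c m = 0) ∧
  Tendsto (fun m : S → ℕ => ‖c m‖ * (q : ℝ) ^ (-(h : ℝ) * (mSum m : ℝ)))
    cofinite (nhds 0) ∧
  ∀ z : F, ‖z - a‖ ≤ (q : ℝ) ^ (-(h : ℤ)) →
    HasSum (fun m : S → ℕ => c m * mPow emb (z - a) m) (f z)

/-- membership in F_h(O_F, J, d) -/
def IsFh (q : ℕ) (emb : S → (F →+* E)) (J : Set S) (d : S → ℕ) (h : ℕ)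
    (f : F → E) : Prop :=
  ∀ a : F, ‖a‖ ≤ 1 → ∃ c : (S → ℕ) → E, IsExpansionAt q emb J d h a c f

/-- membership in F(O_F, J, d) = ∪_h F_h(O_F, J, d) -/
def IsF (q : ℕ) (emb : S → (F →+* E)) (J : Set S) (d : S → ℕ) (f : F → E) : Prop :=
  ∃ h : ℕ, IsFh q emb J d h f

/-- the norm of F_h(O_F, J, d) -/
def FhNorm (q : ℕ) (emb : S → (F →+* E)) (J : Set S) (d : S → ℕ) (h : ℕ)
    (f : F → E) : ℝ :=
  sSup {x | ∃ a : F, ‖a‖ ≤ 1 ∧ ∃ c : (S → ℕ) → E, IsExpansionAt q emb J d h a c f ∧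
        ∃ m : S → ℕ, x = ‖c m‖ * (q : ℝ) ^ (-(h : ℝ) * (mSum m : ℝ))}

/-- membership in F^N(O_F, J, d): member of F(O_F,J,d) which is a sum of members of the
spaces F(O_F, ∅, d'') over multi-indices d'' of total degree ≤ N. -/
def IsFN (q : ℕ) (emb : S → (F →+* E)) (J : Set S) (d : S → ℕ) (N : ℕ)
    (f : F → E) : Prop :=
  IsF q emb J d f ∧ ∃ g : (S → ℕ) → (F → E),
    (∀ m ∈ degLE S N, IsF q emb (∅ : Set S) m (g m)) ∧
    ∀ z : F, ‖z‖ ≤ 1 → f z = ∑ m ∈ degLE S N, g m z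

/-- |d| = Σ_{σ ∉ J} d_σ -/
def dSum (J : Set S) (d : S → ℕ) : ℕ :=
  ∑ σ ∈ Finset.univ.filter (fun σ => σ ∉ J), d σ

/-- z^d = ∏_{σ ∉ J} σ(z)^{d_σ} -/
def dPow (emb : S → (F →+* E)) (J : Set S) (d : S → ℕ) (z : F) : E :=
  ∏ σ ∈ Finset.univ.filter (fun σ => σ ∉ J), (emb σ z) ^ (d σ)

/-- z^{d-k} z^{-m} where (k, m) is encoded by the single multi-index `i`
(k = i off J, m = i on J). -/
def negPow (emb : S → (F →+* E)) (J : Set S) (d : S → ℕ) (i : S → ℕ) (z : F) : E :=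
  (∏ σ ∈ Finset.univ.filter (fun σ => σ ∉ J), (emb σ z) ^ (d σ - i σ)) /
    (∏ σ ∈ Finset.univ.filter (fun σ => σ ∈ J), (emb σ z) ^ (i σ))

/-- the function 1_{D(a,n)}(z) (z-a)^i -/
def test1 (q : ℕ) (emb : S → (F →+* E)) (a : F) (n : ℤ) (i : S → ℕ) : F → E :=
  fun z => if ‖z - a‖ ≤ (q : ℝ) ^ (-n) then mPow emb (z - a) i else 0

/-- the function χ2 χ1⁻¹ -/
def chRatio (χ1 χ2 : F →* E) (z : F) : E := χ2 z / χ1 z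

/-- the function 1_{F∖D(a,n+1)}(z) χ2χ1⁻¹(z-a) (z-a)^{d-k} (z-a)^{-m} -/
def test2 (q : ℕ) (emb : S → (F →+* E)) (J : Set S) (d : S → ℕ) (χ1 χ2 : F →* E)
    (a : F) (n : ℤ) (i : S → ℕ) : F → E :=
  fun z => if ‖z - a‖ ≤ (q : ℝ) ^ (-(n + 1)) then 0
    else chRatio χ1 χ2 (z - a) * negPow emb J d i (z - a)

/-- the ϖ-adic valuation v(a) (so that ‖a‖ = q^{-v(a)} for a ≠ 0) -/
def valF (q : ℕ) (a : F) : ℤ := ⌊-(Real.logb q ‖a‖)⌋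

/-- the function 1_{D(1/a, n - 2v(a))}(z) χ2χ1⁻¹(z) z^d (1/z - a)^k (1/z - a)^m -/
def test3 (q : ℕ) (emb : S → (F →+* E)) (J : Set S) (d : S → ℕ) (χ1 χ2 : F →* E)
    (a : F) (n : ℤ) (i : S → ℕ) : F → E :=
  fun z => if ‖z - a⁻¹‖ ≤ (q : ℝ) ^ (-(n - 2 * valF q a))
    then chRatio χ1 χ2 z * dPow emb J d z * mPow emb (z⁻¹ - a) i else 0

/-- locally J-analytic character: continuous on F^× and, on each disk D(a,l) around a
unit, given by a convergent power series in the variables (σ(z) - σ(a))_{σ ∈ J}. -/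
def IsLocJChar (q : ℕ) (emb : S → (F →+* E)) (J : Set S) (χ : F →* E) : Prop :=
  ContinuousOn (χ : F → E) {z : F | z ≠ 0} ∧
  ∃ l : ℕ, ∀ a : F, ‖a‖ = 1 → ∃ c : (S → ℕ) → E,
    (∀ m : S → ℕ, ¬ (∀ σ, σ ∉ J → m σ = 0) → c m = 0) ∧
    ∀ z : F, ‖z - a‖ ≤ (q : ℝ) ^ (-(l : ℤ)) →
      HasSum (fun m : S → ℕ => c m * mPow emb (z - a) m) (χ z)

/-- the valuation v_p on E normalized by v_p(p) = 1, given that ‖x‖ = p^{-ef·v_p(x)}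
(ef = [F:ℚ_p]). -/
def vP (p : ℕ) (ef : ℕ) (x : E) : ℝ := -(Real.logb p ‖x‖) / (ef : ℝ)

/-- the monomial character z ↦ ∏_{σ ∈ T} σ(z)^{d_σ} -/
def monChar (emb : S → (F →+* E)) (T : Set S) (d : S → ℕ) : F →* E where
  toFun z := ∏ σ ∈ Finset.univ.filter (fun σ => σ ∈ T), (emb σ z) ^ (d σ)
  map_one' := by simp
  map_mul' := by
    intro x y
    simp [map_mul, mul_pow, Finset.prod_mul_distrib]

/-- `g` is (on O_F ∖ {0}) the function z ↦ χ2χ1⁻¹(z) z^d f(1/z); i.e. `g` is an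
extension to O_F of the second-chart transform of `f`. -/
def ExtProp (emb : S → (F →+* E)) (J : Set S) (d : S → ℕ) (χ1 χ2 : F →* E)
    (f g : F → E) : Prop :=
  ∀ z : F, z ≠ 0 → ‖z‖ ≤ 1 → g z = chRatio χ1 χ2 z * dPow emb J d z * f z⁻¹

/-- membership in V(χ, J, d) (global sections of the locally analytic sheaf) -/
def MemV (q : ℕ) (emb : S → (F →+* E)) (J : Set S) (d : S → ℕ) (χ1 χ2 : F →* E)
    (f : F → E) : Prop :=
  IsF q emb J d f ∧ ∃ g : F → E, IsF q emb J d g ∧ ExtProp emb J d χ1 χ2 f g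

/-- membership in the Banach space B(χ, J, d) -/
def MemB (q : ℕ) (emb : S → (F →+* E)) (r : ℝ) (J : Set S) (d : S → ℕ)
    (χ1 χ2 : F →* E) (f : F → E) : Prop :=
  IsCrJ q emb r J d f ∧ ∃ g : F → E, IsCrJ q emb r J d g ∧ ExtProp emb J d χ1 χ2 f g

/-- the norm of B(χ, J, d): ‖f‖_B = max(‖f₁‖_{C^r}, ‖f₂‖_{C^r}) where
f₁(z) = f(ϖ z) and f₂ is the extension of z ↦ χ2χ1⁻¹(z) z^d f(1/z). -/
def BNorm (q : ℕ) (emb : S → (F →+* E)) (r : ℝ) (J : Set S) (d : S → ℕ)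
    (χ1 χ2 : F →* E) (ϖ : F) (f : F → E) : ℝ :=
  sSup {x | ∃ g : F → E, IsCrJ q emb r J d g ∧ ExtProp emb J d χ1 χ2 f g ∧
    x = max (crNorm q emb r (fun z => f (ϖ * z))) (crNorm q emb r g)}

/-- the ring of integers O_E as a subring of E -/
def unitBall (E : Type*) [NormedField E] [IsUltrametricDist E] : Subring E where
  carrier := {x : E | ‖x‖ ≤ 1}
  mul_mem' := by
    intro a b ha hb
    simp only [Set.mem_setOf_eq] at *
    calc ‖a * b‖ = ‖a‖ * ‖b‖ := norm_mul a b
    _ ≤ 1 * 1 := mul_le_mul ha hb (norm_nonneg b) zero_le_one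
    _ = 1 := one_mul 1
  one_mem' := by simp
  add_mem' := by
    intro a b ha hb
    simp only [Set.mem_setOf_eq] at *
    exact le_trans (IsUltrametricDist.norm_add_le_max a b) (max_le ha hb)
  zero_mem' := by simp
  neg_mem' := by
    intro a ha
    simpa using ha

instance (E : Type*) [NormedField E] [IsUltrametricDist E] :
    Algebra (unitBall E) E := (unitBall E).subtype.toAlgebra

/-- the action of the Borel element [[t, u], [0, v]] on functions -/
def borelAct (emb : S → (F →+* E)) (J : Set S) (d : S → ℕ) (χ1 χ2 : F →* E)
    (t u v : F) (f : F → E) : F → E :=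
  fun z => χ1 (t * v) * chRatio χ1 χ2 t * dPow emb J d t * f ((v * z - u) / t)

/-- the generator 1_{O_F}(z) z^k z^m -/
def genPoly (emb : S → (F →+* E)) (i : S → ℕ) : F → E :=
  fun z => if ‖z‖ ≤ 1 then mPow emb z i else 0

/-- the generator 1_{F∖O_F}(z) χ2χ1⁻¹(z) z^{d-k} z^{-m} -/
def genSing (emb : S → (F →+* E)) (J : Set S) (d : S → ℕ) (χ1 χ2 : F →* E)
    (i : S → ℕ) : F → E :=
  fun z => if ‖z‖ ≤ 1 then 0 else chRatio χ1 χ2 z * negPow emb J d i z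

/-- the generating set of Λ: Borel translates of the basic generators -/
def lambdaGens (emb : S → (F →+* E)) (J : Set S) (d : S → ℕ) (χ1 χ2 : F →* E) :
    Set (F → E) :=
  {h | ∃ t u v : F, ∃ i : S → ℕ, t ≠ 0 ∧ v ≠ 0 ∧ (∀ σ, σ ∉ J → i σ ≤ d σ) ∧
    (h = borelAct emb J d χ1 χ2 t u v (genPoly emb i) ∨
     h = borelAct emb J d χ1 χ2 t u v (genSing emb J d χ1 χ2 i))}

/-- the O_E[P]-lattice Λ -/
def Lambda [IsUltrametricDist E] (emb : S → (F →+* E)) (J : Set S) (d : S → ℕ)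
    (χ1 χ2 : F →* E) : Submodule ↥(unitBall E) (F → E) :=
  Submodule.span ↥(unitBall E) (lambdaGens emb J d χ1 χ2)

/-- the gauge (jauge) ‖f‖_Λ = inf{‖λ‖ : λ ∈ E^×, f ∈ λΛ} of a lattice Λ -/
def lamGauge [IsUltrametricDist E] (Λ : Submodule ↥(unitBall E) (F → E))
    (f : F → E) : ℝ :=
  sInf {c : ℝ | ∃ lam : E, lam ≠ 0 ∧ c = ‖lam‖ ∧ ∃ g, g ∈ Λ ∧ f = lam • g}

/-- the formula for the action of g = (a b; c d) ∈ GL₂(F):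
(g·f)(z) = χ1(det g) χ2χ1⁻¹(-cz+a) (-cz+a)^d f((dz-b)/(-cz+a)) -/
def actFormula (emb : S → (F →+* E)) (J : Set S) (d : S → ℕ) (χ1 χ2 : F →* E)
    (g : Matrix (Fin 2) (Fin 2) F) (f : F → E) : F → E :=
  fun z => χ1 (g 0 0 * g 1 1 - g 0 1 * g 1 0) *
    chRatio χ1 χ2 (-(g 1 0) * z + g 0 0) * dPow emb J d (-(g 1 0) * z + g 0 0) *
    f ((g 1 1 * z - g 0 1) / (-(g 1 0) * z + g 0 0))

/-- the action of g ∈ GL₂(F) on functions, extended by continuity (i.e. by taking the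
limit) at the singular point z = a/c when c ≠ 0. -/
def gAct (emb : S → (F →+* E)) (J : Set S) (d : S → ℕ) (χ1 χ2 : F →* E)
    (g : Matrix (Fin 2) (Fin 2) F) (f : F → E) : F → E :=
  fun z => if g 1 0 ≠ 0 ∧ z = g 0 0 / g 1 0 then
      limUnder (𝓝[≠] z) (actFormula emb J d χ1 χ2 g f)
    else actFormula emb J d χ1 χ2 g f z

/-- μ belongs to I(χ,J,d)^∨: both components of μ restrict to continuous linear forms
on each Banach space F_h(O_F,J,d). -/
def MemIdual (q : ℕ) (emb : S → (F →+* E)) (J : Set S) (d : S → ℕ) (χ1 χ2 : F →* E)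
    (ϖ : F) (μ : (F → E) →ₗ[E] E) : Prop :=
  ∀ h : ℕ, ∃ K : ℝ, ∀ f g : F → E,
    IsFh q emb J d h (fun z => f (ϖ * z)) → IsFh q emb J d h g →
    ExtProp emb J d χ1 χ2 f g →
    ‖μ f‖ ≤ K * max (FhNorm q emb J d h (fun z => f (ϖ * z))) (FhNorm q emb J d h g)

/-- ν is a continuous (= bounded) linear form on the Banach space B(χ,J,d) -/
def BBounded (q : ℕ) (emb : S → (F →+* E)) (r : ℝ) (J : Set S) (d : S → ℕ)
    (χ1 χ2 : F →* E) (ϖ : F) (ν : (F → E) →ₗ[E] E) : Prop :=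
  ∃ K : ℝ, ∀ f : F → E, MemB q emb r J d χ1 χ2 f →
    ‖ν f‖ ≤ K * BNorm q emb r J d χ1 χ2 ϖ f

/-- the function z ↦ z^k z^m (a generator of L(χ,J,d)) -/
def lFun1 (emb : S → (F →+* E)) (i : S → ℕ) : F → E := fun z => mPow emb z i

/-- the function z ↦ χ2χ1⁻¹(z-a) (z-a)^{d-k} (z-a)^{-m} (value 0 at z = a),
a generator of L(χ,J,d) -/
def lFun2 (emb : S → (F →+* E)) (J : Set S) (d : S → ℕ) (χ1 χ2 : F →* E)
    (a : F) (i : S → ℕ) : F → E :=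
  fun z => if z = a then 0 else chRatio χ1 χ2 (z - a) * negPow emb J d i (z - a)

/-- the generating set of L(χ,J,d) -/
def lGens (emb : S → (F →+* E)) (J : Set S) (d : S → ℕ) (χ1 χ2 : F →* E)
    (r : ℝ) : Set (F → E) :=
  {h | ∃ i : S → ℕ, (∀ σ, σ ∉ J → i σ ≤ d σ) ∧ (mSum i : ℝ) < r ∧
    (h = lFun1 emb i ∨ ∃ a : F, h = lFun2 emb J d χ1 χ2 a i)}

/-- the distance in B(χ,J,d) from f to the subspace L(χ,J,d), i.e. the quotient
seminorm of B(χ,J,d)/L(χ,J,d) evaluated at the image of f. -/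
def distL (q : ℕ) (emb : S → (F →+* E)) (r : ℝ) (J : Set S) (d : S → ℕ)
    (χ1 χ2 : F →* E) (ϖ : F) (f : F → E) : ℝ :=
  sInf {x | ∃ l ∈ Submodule.span E (lGens emb J d χ1 χ2 r),
    x = BNorm q emb r J d χ1 χ2 ϖ (f - l)}

/-- the GL₂(F)-stable lattice generated by Λ under the group action -/
def LambdaG [IsUltrametricDist E] (emb : S → (F →+* E)) (J : Set S) (d : S → ℕ)
    (χ1 χ2 : F →* E) : Submodule ↥(unitBall E) (F → E) :=
  Submodule.span ↥(unitBall E)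
    {h | ∃ g : Matrix (Fin 2) (Fin 2) F, g 0 0 * g 1 1 - g 0 1 * g 1 0 ≠ 0 ∧
      ∃ x, x ∈ Lambda emb J d χ1 χ2 ∧ h = gAct emb J d χ1 χ2 g x}

/-- C^{r,id} remainder for h : O_F → F -/
def crRemId (N : ℕ) (h : F → F) (Dh : ℕ → F → F) (x y : F) : F :=
  h (x + y) - ∑ i ∈ Finset.range (N + 1), Dh i x * y ^ i / (Nat.factorial i : F)

/-- h : O_F → F is of class C^{r,id} -/
def IsCrId (q : ℕ) (r : ℝ) (h : F → F) : Prop :=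
  ∃ Dh : ℕ → F → F,
    (∀ i : ℕ, i ≤ ⌊r⌋₊ → ∃ C : ℝ, ∀ x : F, ‖x‖ ≤ 1 → ‖Dh i x‖ ≤ C) ∧
    ∀ ε : ℝ, 0 < ε → ∃ K : ℕ, ∀ k : ℕ, K ≤ k → ∀ x y : F, ‖x‖ ≤ 1 →
      ‖y‖ ≤ (q : ℝ) ^ (-(k : ℤ)) → ‖crRemId ⌊r⌋₊ h Dh x y‖ * (q : ℝ) ^ (r * (k : ℝ)) ≤ ε

/-- the set of values defining the dual norm ‖μ‖_{r,d} -/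
def dualSet (q : ℕ) (emb : S → (F →+* E)) (r : ℝ) (J : Set S) (d : S → ℕ)
    (μ : (F → E) →ₗ[E] E) : Set ℝ :=
  {x | ∃ (a : F) (n : ℕ) (i : S → ℕ), ‖a‖ ≤ 1 ∧ (∀ σ, σ ∉ J → i σ ≤ d σ) ∧
    x = ‖μ (test1 q emb a (n : ℤ) i)‖ * (q : ℝ) ^ (-(n : ℝ) * (r - (mSum i : ℝ)))}

/-- the dual norm ‖μ‖_{r,d} -/
def dualNorm (q : ℕ) (emb : S → (F →+* E)) (r : ℝ) (J : Set S) (d : S → ℕ)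
    (μ : (F → E) →ₗ[E] E) : ℝ :=
  sSup (dualSet q emb r J d μ)

/-- the operator norm of μ on C^r(O_F, J, d) -/
def opNorm (q : ℕ) (emb : S → (F →+* E)) (r : ℝ) (J : Set S) (d : S → ℕ)
    (μ : (F → E) →ₗ[E] E) : ℝ :=
  sSup {x | ∃ f : F → E, IsCrJ q emb r J d f ∧ crNorm q emb r f ≠ 0 ∧
    x = ‖μ f‖ / crNorm q emb r f}


lemma mem_degLE {N : ℕ} {i : S → ℕ} : i ∈ degLE S N ↔ mSum i ≤ N := by
  unfold degLE
  simp only [Finset.mem_filter, Finset.mem_image, Finset.mem_univ, true_and, and_iff_right_iff_imp]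
  intro h
  have hle : ∀ σ, i σ ≤ N := fun σ =>
    (Finset.single_le_sum (f := i) (fun _ _ => Nat.zero_le _) (Finset.mem_univ σ)).trans h
  exact ⟨fun σ => ⟨i σ, Nat.lt_succ_of_le (hle σ)⟩, rfl⟩

lemma mPow_mul (emb : S → (F →+* E)) (x y : F) (i : S → ℕ) :
    mPow emb (x * y) i = mPow emb x i * mPow emb y i := by
  simp [mPow, mul_pow, Finset.prod_mul_distrib]

lemma mPow_inv (emb : S → (F →+* E)) (x : F) (i : S → ℕ) :
    mPow emb x⁻¹ i = (mPow emb x i)⁻¹ := by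
  simp [mPow, Finset.prod_inv_distrib]

lemma mPow_div (emb : S → (F →+* E)) (x y : F) (i : S → ℕ) :
    mPow emb (x / y) i = mPow emb x i / mPow emb y i := by
  rw [div_eq_mul_inv, mPow_mul, mPow_inv, div_eq_mul_inv]

lemma mPow_ne_zero (emb : S → (F →+* E)) {x : F} (hx : x ≠ 0) (i : S → ℕ) :
    mPow emb x i ≠ 0 :=
  Finset.prod_ne_zero_iff.2 fun σ _ => pow_ne_zero _ ((map_ne_zero (emb σ)).2 hx)

lemma norm_mPow {emb : S → (F →+* E)} (hemb : ∀ σ z, ‖emb σ z‖ = ‖z‖) (z : F) (i : S → ℕ) :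
    ‖mPow emb z i‖ = ‖z‖ ^ mSum i := by
  simp [mPow, mSum, norm_prod, hemb, Finset.prod_pow_eq_pow_sum]

/-- The multi-index binomial coefficient. -/
def mChoose (i m : S → ℕ) : ℕ := ∏ σ, (i σ).choose (m σ)

lemma mChoose_eq_zero {i m : S → ℕ} {σ : S} (h : i σ < m σ) : mChoose i m = 0 :=
  Finset.prod_eq_zero (Finset.mem_univ σ) (Nat.choose_eq_zero_of_lt h)

lemma mSum_mono {i m : S → ℕ} (h : ∀ σ, m σ ≤ i σ) : mSum m ≤ mSum i :=
  Finset.sum_le_sum fun σ _ => h σ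

/-- The multi-index binomial formula. -/
lemma mPow_add (emb : S → (F →+* E)) (x y : F) {N : ℕ} {i : S → ℕ} (hi : mSum i ≤ N) :
    mPow emb (x + y) i = ∑ m ∈ degLE S N,
      (mChoose i m : E) * mPow emb x (fun σ => i σ - m σ) * mPow emb y m := by
  have h1 : mPow emb (x + y) i = ∑ m ∈ Fintype.piFinset (fun σ => Finset.range (i σ + 1)),
      (mChoose i m : E) * mPow emb x (fun σ => i σ - m σ) * mPow emb y m := by
    unfold mPow
    have h2 : ∀ σ, emb σ (x + y) ^ i σ = ∑ k ∈ Finset.range (i σ + 1),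
        ((i σ).choose k : E) * (emb σ x) ^ (i σ - k) * (emb σ y) ^ k := by
      intro σ
      rw [map_add, add_comm, add_pow]
      exact Finset.sum_congr rfl fun k _ => by ring
    simp_rw [h2]
    rw [Finset.prod_univ_sum]
    refine Finset.sum_congr rfl fun m _ => ?_
    rw [Finset.prod_mul_distrib, Finset.prod_mul_distrib, mChoose]
    push_cast
    rfl
  rw [h1]
  refine Finset.sum_subset (fun m hm => ?_) (fun m _ hm => ?_)
  · rw [mem_degLE]
    refine (mSum_mono fun σ => ?_).trans hi
    have := Fintype.mem_piFinset.1 hm σ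
    exact Nat.lt_succ_iff.1 (Finset.mem_range.1 this)
  · rw [Fintype.mem_piFinset] at hm
    push Not at hm
    obtain ⟨σ, hσ⟩ := hm
    rw [mChoose_eq_zero (σ := σ) (by simpa [Nat.lt_succ_iff] using hσ)]
    simp

section Taylor

open MvPolynomial

/-- A polynomial without terms of degree `< k` is `O(‖t‖ ^ k)` on the unit ball. -/
lemma exists_norm_eval_le {emb : S → (F →+* E)} (hemb : ∀ σ z, ‖emb σ z‖ = ‖z‖)
    (P : MvPolynomial S E) (k : ℕ) (hP : ∀ m ∈ P.support, k ≤ ∑ σ, m σ) :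
    ∃ M : ℝ, 0 ≤ M ∧ ∀ t : F, ‖t‖ ≤ 1 → ‖eval (fun σ => emb σ t) P‖ ≤ M * ‖t‖ ^ k := by
  refine ⟨∑ m ∈ P.support, ‖P.coeff m‖, Finset.sum_nonneg fun _ _ => norm_nonneg _, ?_⟩
  intro t ht
  rw [eval_eq', Finset.sum_mul]
  refine (norm_sum_le _ _).trans (Finset.sum_le_sum fun m hm => ?_)
  rw [norm_mul, norm_prod]
  simp only [norm_pow, hemb, Finset.prod_pow_eq_pow_sum]
  exact mul_le_mul_of_nonneg_left (pow_le_pow_of_le_one (norm_nonneg _) ht (hP m hm))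
    (norm_nonneg _)

/-- `Φ` agrees near `0` up to order `N` with a polynomial in the `σ(t)` whose degree in `σ(t)` is
at most `b σ` for `σ ∉ J`. -/
def HasTaylor (emb : S → (F →+* E)) (J : Set S) (N : ℕ) (b : S → ℕ) (Φ : F → E) : Prop :=
  ∃ P : MvPolynomial S E, (∀ σ, σ ∉ J → P.degreeOf σ ≤ b σ) ∧ ∃ δ : ℝ, 0 < δ ∧ ∃ M : ℝ, 0 ≤ M ∧
    ∀ t : F, ‖t‖ ≤ δ → ‖Φ t - eval (fun σ => emb σ t) P‖ ≤ M * ‖t‖ ^ (N + 1)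

lemma HasTaylor.mul {emb : S → (F →+* E)} (hemb : ∀ σ z, ‖emb σ z‖ = ‖z‖) {J : Set S} {N : ℕ}
    {b b' : S → ℕ} {Φ Ψ : F → E} (h : HasTaylor emb J N b Φ) (h' : HasTaylor emb J N b' Ψ) :
    HasTaylor emb J N (fun σ => b σ + b' σ) (fun t => Φ t * Ψ t) := by
  obtain ⟨P, hP, δ, hδ, M, hM, H⟩ := h
  obtain ⟨Q, hQ, δ', hδ', M', hM', H'⟩ := h'
  obtain ⟨A, hA, HA⟩ := exists_norm_eval_le hemb P 0 (by simp)
  obtain ⟨B, hB, HB⟩ := exists_norm_eval_le hemb Q 0 (by simp)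
  refine ⟨P * Q, fun σ hσ => (degreeOf_mul_le _ _ _).trans (add_le_add (hP σ hσ) (hQ σ hσ)),
    min 1 (min δ δ'), by positivity, M * (M' + B) + A * M', by positivity, ?_⟩
  intro t ht
  have ht1 : ‖t‖ ≤ 1 := ht.trans (min_le_left _ _)
  have h1 := H t (ht.trans ((min_le_right _ _).trans (min_le_left _ _)))
  have h2 := H' t (ht.trans ((min_le_right _ _).trans (min_le_right _ _)))
  have h3 := HA t ht1
  have h4 := HB t ht1
  simp only [pow_zero, mul_one] at h3 h4
  have h5 : ‖t‖ ^ (N + 1) ≤ 1 := pow_le_one₀ (norm_nonneg _) ht1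
  set p := eval (fun σ => emb σ t) P
  set u := eval (fun σ => emb σ t) Q
  have h6 : ‖Ψ t‖ ≤ M' + B := by
    calc ‖Ψ t‖ = ‖(Ψ t - u) + u‖ := by rw [sub_add_cancel]
      _ ≤ ‖Ψ t - u‖ + ‖u‖ := norm_add_le _ _
      _ ≤ M' + B := add_le_add (h2.trans (mul_le_of_le_one_right hM' h5)) h4
  rw [map_mul, show Φ t * Ψ t - p * u = (Φ t - p) * Ψ t + p * (Ψ t - u) by ring]
  refine (norm_add_le _ _).trans ?_
  rw [norm_mul, norm_mul]
  have h7 := mul_le_mul h1 h6 (norm_nonneg _) (by positivity)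
  have h8 := mul_le_mul h3 h2 (norm_nonneg _) hA
  calc _ ≤ _ := add_le_add h7 h8
    _ = _ := by ring

lemma HasTaylor.inv {emb : S → (F →+* E)} (hemb : ∀ σ z, ‖emb σ z‖ = ‖z‖) {J : Set S} {N : ℕ}
    {Φ : F → E} (h : HasTaylor emb J N (fun _ => 0) Φ) (h0 : Φ 0 = 1)
    (h1 : ∀ t, ‖t‖ < 1 → ‖Φ t‖ = 1) :
    HasTaylor emb J N (fun _ => 0) (fun t => (Φ t)⁻¹) := by
  obtain ⟨P, hP, δ, hδ, M, hM, H⟩ := h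
  have hP0 : constantCoeff P = 1 := by
    have := H 0 (by simpa using hδ.le)
    simp only [h0, map_zero, norm_zero, ne_eq, Nat.add_eq_zero_iff, one_ne_zero, and_false,
      not_false_eq_true, zero_pow, mul_zero, norm_le_zero_iff, sub_eq_zero] at this
    rw [this]
    exact (congrFun (congrArg _ (MvPolynomial.eval_zero' (R := E) (σ := S))) P).symm
  obtain ⟨A, hA, HA⟩ := exists_norm_eval_le hemb (1 - P) 1 (by
    intro m hm
    by_contra hlt
    have hm0 : m = 0 := by
      ext σ
      have : ∑ σ, m σ = 0 := by omega
      simpa using (Finset.sum_eq_zero_iff.1 this) σ (Finset.mem_univ σ)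
    rw [mem_support_iff] at hm
    apply hm
    rw [hm0, ← constantCoeff_eq, map_sub, hP0, map_one, sub_self])
  set Q : MvPolynomial S E := ∑ k ∈ Finset.range (N + 1), (1 - P) ^ k with hQ
  obtain ⟨B, hB, HB⟩ := exists_norm_eval_le hemb Q 0 (by simp)
  have hPQ : P * Q = 1 - (1 - P) ^ (N + 1) := by
    have := mul_neg_geom_sum (1 - P) (N + 1)
    rwa [sub_sub_cancel] at this
  refine ⟨Q, fun σ hσ => ?_, min δ (1 / 2), by positivity, M * B + A ^ (N + 1), by positivity, ?_⟩
  · refine (degreeOf_sum_le _ _ _).trans (Finset.sup_le fun k _ => ?_)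
    refine (degreeOf_pow_le _ _ _).trans ?_
    have h2 := degreeOf_sub_le σ (1 : MvPolynomial S E) P
    have h3 := hP σ hσ
    rw [degreeOf_one] at h2
    have h4 : degreeOf σ (1 - P) = 0 := by
      simp only at h3
      rw [Nat.le_zero.1 h3] at h2
      simpa using h2
    simp [h4]
  · intro t ht
    have ht1 : ‖t‖ < 1 := (ht.trans (min_le_right _ _)).trans_lt (by norm_num)
    have h2 := H t (ht.trans (min_le_left _ _))
    have h3 := HA t ht1.le
    have h4 := HB t ht1.le
    have h5 := congrArg (eval (fun σ => emb σ t)) hPQ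
    simp only [map_mul, map_sub, map_one, map_pow, pow_zero, mul_one, pow_one] at h3 h4 h5
    set p := eval (fun σ => emb σ t) P
    set u := eval (fun σ => emb σ t) Q
    have hne : Φ t ≠ 0 := by
      rw [← norm_ne_zero_iff, h1 t ht1]
      exact one_ne_zero
    have h6 : (Φ t)⁻¹ - u = (Φ t)⁻¹ * ((1 - p) ^ (N + 1) - (Φ t - p) * u) := by
      have : (1 - p) ^ (N + 1) = 1 - p * u := by rw [h5]; ring
      rw [this]
      field_simp
      ring
    rw [h6, norm_mul, norm_inv, h1 t ht1, inv_one, one_mul]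
    refine (norm_sub_le _ _).trans ?_
    rw [norm_pow, norm_mul]
    have h7 := mul_le_mul h2 h4 (norm_nonneg _) (by positivity)
    have h8 := pow_le_pow_left₀ (norm_nonneg _) h3 (N + 1)
    calc _ ≤ _ := add_le_add h8 h7
      _ = _ := by ring

/-- The polynomial with coefficients `c m` in degrees `≤ N`. -/
def truncPoly (N : ℕ) (c : (S → ℕ) → E) : MvPolynomial S E :=
  ∑ m ∈ degLE S N, monomial (Finsupp.equivFunOnFinite.symm m) (c m)

lemma eval_truncPoly (emb : S → (F →+* E)) (N : ℕ) (c : (S → ℕ) → E) (t : F) :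
    eval (fun σ => emb σ t) (truncPoly N c) = ∑ m ∈ degLE S N, c m * mPow emb t m := by
  simp only [truncPoly, map_sum, eval_monomial]
  refine Finset.sum_congr rfl fun m _ => ?_
  rw [Finsupp.prod_fintype _ _ (by simp)]
  rfl

lemma coeff_truncPoly (N : ℕ) (c : (S → ℕ) → E) (m : S →₀ ℕ) :
    (truncPoly N c).coeff m = if ∑ σ, m σ ≤ N then c m else 0 := by
  simp only [truncPoly, coeff_sum, coeff_monomial]
  have : ∀ x : S → ℕ, (Finsupp.equivFunOnFinite.symm x = m) ↔ (x = ⇑m) := fun x => by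
    rw [Equiv.symm_apply_eq]; rfl
  simp only [this, Finset.sum_ite_eq', mem_degLE, mSum]

lemma degreeOf_truncPoly_le (N : ℕ) (c : (S → ℕ) → E) (σ : S) (b : ℕ)
    (hc : ∀ m, b < m σ → c m = 0) : (truncPoly N c).degreeOf σ ≤ b := by
  rw [degreeOf_le_iff]
  intro m hm
  by_contra hlt
  rw [mem_support_iff, coeff_truncPoly] at hm
  exact hm (by rw [hc _ (not_le.1 hlt), ite_self])

lemma HasTaylor.exists_coeff {emb : S → (F →+* E)} (hemb : ∀ σ z, ‖emb σ z‖ = ‖z‖) {J : Set S}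
    {N : ℕ} {b : S → ℕ} {Φ : F → E} (h : HasTaylor emb J N b Φ) :
    ∃ c : (S → ℕ) → E, (∀ m σ, σ ∉ J → b σ < m σ → c m = 0) ∧ ∃ δ : ℝ, 0 < δ ∧ ∃ M : ℝ, 0 ≤ M ∧
      ∀ t : F, ‖t‖ ≤ δ →
        ‖Φ t - ∑ m ∈ degLE S N, c m * mPow emb t m‖ ≤ M * ‖t‖ ^ (N + 1) := by
  obtain ⟨P, hP, δ, hδ, M, hM, H⟩ := h
  set c : (S → ℕ) → E := fun m => P.coeff (Finsupp.equivFunOnFinite.symm m) with hc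
  obtain ⟨A, hA, HA⟩ := exists_norm_eval_le hemb (P - truncPoly N c) (N + 1) (by
    intro m hm
    by_contra hlt
    rw [mem_support_iff, coeff_sub, coeff_truncPoly, if_pos (by omega)] at hm
    exact hm (by simp [hc]))
  refine ⟨c, fun m σ hσ hlt => ?_, min 1 δ, by positivity, M + A, by positivity, fun t ht => ?_⟩
  · exact notMem_support_iff.1 (notMem_support_of_degreeOf_lt σ ((hP σ hσ).trans_lt hlt))
  · have h1 := H t (ht.trans (min_le_right _ _))
    have h2 := HA t (ht.trans (min_le_left _ _))
    rw [map_sub, eval_truncPoly] at h2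
    rw [← sub_add_sub_cancel _ (eval (fun σ => emb σ t) P), add_mul]
    exact (norm_add_le _ _).trans (add_le_add h1 h2)

/-- Truncation of a convergent power series. -/
lemma hasTaylor_of_hasSum [IsUltrametricDist E] {emb : S → (F →+* E)}
    (hemb : ∀ σ z, ‖emb σ z‖ = ‖z‖) {J : Set S} (N : ℕ) {b : S → ℕ} {Φ : F → E}
    {c : (S → ℕ) → E} (hc : ∀ m σ, σ ∉ J → b σ < m σ → c m = 0) {t₀ : F} (ht₀ : t₀ ≠ 0)
    (h : ∀ t : F, ‖t‖ ≤ ‖t₀‖ → HasSum (fun m => c m * mPow emb t m) (Φ t)) :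
    HasTaylor emb J N b Φ := by
  have hpos : 0 < ‖t₀‖ := norm_pos_iff.2 ht₀
  obtain ⟨A, hA⟩ := ((h t₀ le_rfl).summable.tendsto_cofinite_zero.norm).bddAbove_range_of_cofinite
  have hA' : ∀ m, ‖c m‖ * ‖t₀‖ ^ mSum m ≤ A := fun m => by
    have := hA ⟨m, rfl⟩
    simpa [norm_mul, norm_mPow hemb] using this
  have hA0 : 0 ≤ A := (by positivity : (0 : ℝ) ≤ ‖c 0‖ * ‖t₀‖ ^ mSum (0 : S → ℕ)).trans (hA' 0)
  refine ⟨truncPoly N c, fun σ hσ => degreeOf_truncPoly_le N c σ _ fun m hm => hc m σ hσ hm,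
    ‖t₀‖, hpos, A / ‖t₀‖ ^ (N + 1), by positivity, fun t ht => ?_⟩
  rw [eval_truncPoly]
  have h1 : HasSum (fun m => if m ∈ degLE S N then c m * mPow emb t m else 0)
      (∑ m ∈ degLE S N, c m * mPow emb t m) := by
    have : HasSum (fun m => if m ∈ degLE S N then c m * mPow emb t m else 0)
        (∑ m ∈ degLE S N, if m ∈ degLE S N then c m * mPow emb t m else 0) :=
      hasSum_sum_of_ne_finset_zero fun m hm => if_neg hm
    rwa [Finset.sum_congr rfl fun m hm => if_pos hm] at this
  have h2 := (h t ht).sub h1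
  rw [← h2.tsum_eq]
  refine IsUltrametricDist.norm_tsum_le_of_forall_le_of_nonneg (by positivity) fun m => ?_
  split_ifs with hm
  · simpa using by positivity
  · rw [sub_zero, norm_mul, norm_mPow hemb]
    rw [mem_degLE, not_le] at hm
    have h3 : (‖t‖ / ‖t₀‖) ^ mSum m ≤ (‖t‖ / ‖t₀‖) ^ (N + 1) :=
      pow_le_pow_of_le_one (by positivity) (div_le_one_of_le₀ ht hpos.le) hm
    calc ‖c m‖ * ‖t‖ ^ mSum m = (‖c m‖ * ‖t₀‖ ^ mSum m) * (‖t‖ / ‖t₀‖) ^ mSum m := by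
          rw [div_pow]; field_simp
      _ ≤ A * (‖t‖ / ‖t₀‖) ^ (N + 1) := mul_le_mul (hA' m) h3 (by positivity) hA0
      _ = _ := by rw [div_pow]; ring

lemma hasTaylor_prod (emb : S → (F →+* E)) (J T : Set S) (N : ℕ) (k : S → ℕ) :
    HasTaylor emb J N (fun σ => if σ ∈ T then k σ else 0)
      (fun t => ∏ σ ∈ Finset.univ.filter (fun σ => σ ∈ T), (emb σ (1 + t)) ^ k σ) := by
  refine ⟨∏ σ ∈ Finset.univ.filter (fun σ => σ ∈ T), (1 + X σ) ^ k σ, fun τ _ => ?_, 1, one_pos,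
    0, le_rfl, fun t _ => by simp⟩
  have h1 : ∀ σ, degreeOf τ (1 + X σ : MvPolynomial S E) ≤ if τ = σ then 1 else 0 := fun σ => by
    have := degreeOf_add_le τ (1 : MvPolynomial S E) (X σ)
    rwa [degreeOf_one, degreeOf_X, Nat.zero_max] at this
  calc _ ≤ _ := degreeOf_prod_le _ _ _
    _ ≤ ∑ σ ∈ Finset.univ.filter (fun σ => σ ∈ T), k σ * (if τ = σ then 1 else 0) :=
      Finset.sum_le_sum fun σ _ => (degreeOf_pow_le _ _ _).trans (Nat.mul_le_mul_left _ (h1 σ))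
    _ = _ := by simp

end Taylor

omit [Fintype S] in
lemma HasTaylor.mono {emb : S → (F →+* E)} {J : Set S} {N : ℕ} {b b' : S → ℕ} {Φ : F → E}
    (h : HasTaylor emb J N b Φ) (hb : ∀ σ, σ ∉ J → b σ ≤ b' σ) : HasTaylor emb J N b' Φ := by
  obtain ⟨P, hP, H⟩ := h
  exact ⟨P, fun σ hσ => (hP σ hσ).trans (hb σ hσ), H⟩

section Characters

lemma norm_eq_one_of_norm_sub_one_lt {K : Type*} [NormedField K] [IsUltrametricDist K] {x : K}
    (h : ‖x - 1‖ < 1) : ‖x‖ = 1 := by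
  have := IsUltrametricDist.norm_add_eq_max_of_norm_ne_norm (x := x - 1) (y := 1)
    (by rw [norm_one]; exact h.ne)
  rw [sub_add_cancel, norm_one, max_eq_right h.le] at this
  exact this

lemma norm_sub_le_max_norm {K : Type*} [NormedField K] [IsUltrametricDist K] (x y : K) :
    ‖x - y‖ ≤ max ‖x‖ ‖y‖ := by
  rw [sub_eq_add_neg, ← norm_neg y]
  exact IsUltrametricDist.norm_add_le_max x (-y)

lemma exists_finset_cover {q : ℕ}
    (hres : ∀ (a : F) (n : ℤ), ∃ R : Finset F, R.card = q ∧
      (∀ x ∈ R, ‖x - a‖ ≤ (q : ℝ) ^ (-n)) ∧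
      ∀ z : F, ‖z - a‖ ≤ (q : ℝ) ^ (-n) → ∃! x, x ∈ R ∧ ‖z - x‖ ≤ (q : ℝ) ^ (-(n + 1)))
    (h : ℕ) : ∃ R : Finset F, ∀ z : F, ‖z‖ ≤ 1 → ∃ x ∈ R, ‖z - x‖ ≤ (q : ℝ) ^ (-(h : ℤ)) := by
  induction h with
  | zero => exact ⟨{0}, fun z hz => ⟨0, by simp, by simpa using hz⟩⟩
  | succ h ih =>
    obtain ⟨R, hR⟩ := ih
    choose T _ _ hT using fun x : F => hres x h
    refine ⟨R.biUnion T, fun z hz => ?_⟩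
    obtain ⟨x, hx, hzx⟩ := hR z hz
    obtain ⟨y, ⟨hy, hzy⟩, _⟩ := hT x z hzx
    exact ⟨y, Finset.mem_biUnion.2 ⟨x, hx, hy⟩, by push_cast; exact hzy⟩

lemma exists_pow_near_one [IsUltrametricDist F] {q : ℕ} (hq : 1 < q)
    (hres : ∀ (a : F) (n : ℤ), ∃ R : Finset F, R.card = q ∧
      (∀ x ∈ R, ‖x - a‖ ≤ (q : ℝ) ^ (-n)) ∧
      ∀ z : F, ‖z - a‖ ≤ (q : ℝ) ^ (-n) → ∃! x, x ∈ R ∧ ‖z - x‖ ≤ (q : ℝ) ^ (-(n + 1)))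
    {u : F} (hu : ‖u‖ = 1) {ε : ℝ} (hε : 0 < ε) : ∃ k : ℕ, k ≠ 0 ∧ ‖u ^ k - 1‖ < ε := by
  obtain ⟨h, hh⟩ := exists_pow_lt_of_lt_one hε
    (inv_lt_one_of_one_lt₀ (by exact_mod_cast hq : (1 : ℝ) < q))
  obtain ⟨R, hR⟩ := exists_finset_cover hres h
  choose g hg hg' using fun k : ℕ => hR (u ^ k) (by simp [hu])
  obtain ⟨a, b, hab, heq⟩ := Finite.exists_ne_map_eq_of_infinite
    (fun k : ℕ => (⟨g k, hg k⟩ : {x // x ∈ R}))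
  have heq' : g a = g b := congrArg Subtype.val heq
  wlog hlt : a < b generalizing a b
  · exact this b a hab.symm heq.symm heq'.symm (lt_of_le_of_ne (not_lt.1 hlt) hab.symm)
  refine ⟨b - a, by omega, ?_⟩
  have h1 : ‖u ^ b - u ^ a‖ ≤ (q : ℝ) ^ (-(h : ℤ)) := by
    have h2 := norm_sub_le_max_norm (u ^ b - g b) (u ^ a - g a)
    rw [heq', sub_sub_sub_cancel_right] at h2
    exact h2.trans (max_le (hg' b) (heq' ▸ hg' a))
  have h3 : u ^ b - u ^ a = u ^ a * (u ^ (b - a) - 1) := by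
    rw [mul_sub, ← pow_add, Nat.add_sub_cancel' hlt.le, mul_one]
  rw [h3, norm_mul, norm_pow, hu, one_pow, one_mul, zpow_neg, zpow_natCast, ← inv_pow] at h1
  exact h1.trans_lt hh

variable [IsUltrametricDist F] [IsUltrametricDist E]

lemma norm_char_unit {q : ℕ} (hq : 1 < q)
    (hres : ∀ (a : F) (n : ℤ), ∃ R : Finset F, R.card = q ∧
      (∀ x ∈ R, ‖x - a‖ ≤ (q : ℝ) ^ (-n)) ∧
      ∀ z : F, ‖z - a‖ ≤ (q : ℝ) ^ (-n) → ∃! x, x ∈ R ∧ ‖z - x‖ ≤ (q : ℝ) ^ (-(n + 1)))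
    {χ : F →* E} (hχ : ContinuousOn (χ : F → E) {z : F | z ≠ 0}) {u : F} (hu : ‖u‖ = 1) :
    ‖χ u‖ = 1 := by
  have hc : ContinuousAt (χ : F → E) 1 :=
    hχ.continuousAt (isOpen_ne.mem_nhds (one_ne_zero : (1 : F) ≠ 0))
  obtain ⟨ε, hε, H⟩ := Metric.continuousAt_iff.1 hc 1 one_pos
  obtain ⟨k, hk, hk'⟩ := exists_pow_near_one hq hres hu hε
  have h1 := H (x := u ^ k) (by rwa [dist_eq_norm])
  rw [map_one, dist_eq_norm] at h1
  have h2 := norm_eq_one_of_norm_sub_one_lt h1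
  rw [map_pow, norm_pow] at h2
  exact (pow_eq_one_iff_of_nonneg (norm_nonneg _) hk).1 h2

/-- A continuous character has absolute value a power of `‖z‖`. -/
lemma norm_char {p q e : ℕ} (hq : 1 < q) (he : 0 < e)
    (hval : ∀ x : F, x ≠ 0 → ∃ n : ℤ, ‖x‖ = (q : ℝ) ^ n)
    (hres : ∀ (a : F) (n : ℤ), ∃ R : Finset F, R.card = q ∧
      (∀ x ∈ R, ‖x - a‖ ≤ (q : ℝ) ^ (-n)) ∧
      ∀ z : F, ‖z - a‖ ≤ (q : ℝ) ^ (-n) → ∃! x, x ∈ R ∧ ‖z - x‖ ≤ (q : ℝ) ^ (-(n + 1)))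
    (hpF : ‖(p : F)‖ = (q : ℝ) ^ (-(e : ℤ)))
    {χ : F →* E} (hχ : ContinuousOn (χ : F → E) {z : F | z ≠ 0}) {α : ℝ}
    (hα : ‖χ (p : F)‖ = ‖(p : F)‖ ^ α) {z : F} (hz : z ≠ 0) : ‖χ z‖ = ‖z‖ ^ α := by
  have hq0 : (0 : ℝ) < q := by positivity
  obtain ⟨n, hn⟩ := hval z hz
  obtain ⟨a, b, hab⟩ : ∃ a b : ℕ, n = a - b := ⟨n.toNat, (-n).toNat, by omega⟩
  have hp0 : (p : F) ≠ 0 := norm_pos_iff.1 (by rw [hpF]; positivity)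
  have hpb : (p : F) ^ b ≠ 0 := pow_ne_zero _ hp0
  set u : F := z ^ e * (p : F) ^ a / (p : F) ^ b with hu
  have hu1 : ‖u‖ = 1 := by
    rw [hu, norm_div, norm_mul, norm_pow, norm_pow, norm_pow, hn, hpF, ← zpow_natCast,
      ← zpow_natCast, ← zpow_natCast, ← zpow_mul, ← zpow_mul, ← zpow_mul,
      ← zpow_add₀ hq0.ne', ← zpow_sub₀ hq0.ne', hab]
    convert zpow_zero (q : ℝ) using 2
    ring
  have h1 : z ^ e * (p : F) ^ a = u * (p : F) ^ b := by rw [hu, div_mul_cancel₀ _ hpb]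
  have h2 := congrArg (fun x => ‖χ x‖) h1
  simp only [map_mul, map_pow, norm_mul, norm_pow, norm_char_unit hq hres hχ hu1, one_mul, hα] at h2
  have h3 := congrArg (fun x => ‖x‖ ^ α) h1
  simp only [norm_mul, norm_pow, hu1, one_mul] at h3
  rw [Real.mul_rpow (by positivity) (by positivity)] at h3
  have hcomm : ∀ (x : ℝ) (k : ℕ), 0 ≤ x → (x ^ k) ^ α = (x ^ α) ^ k := fun x k hx => by
    rw [← Real.rpow_natCast_mul hx, mul_comm, Real.rpow_mul_natCast hx]
  rw [hcomm _ _ (norm_nonneg _), hcomm _ _ (norm_nonneg _), hcomm _ _ (norm_nonneg _)] at h3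
  have hpa : (‖(p : F)‖ ^ α) ^ a ≠ 0 :=
    pow_ne_zero _ (Real.rpow_pos_of_pos (norm_pos_iff.2 hp0) _).ne'
  have h4 : ‖χ z‖ ^ e = (‖z‖ ^ α) ^ e := mul_right_cancel₀ hpa (h2.trans h3.symm)
  exact (pow_left_inj₀ (norm_nonneg _) (by positivity) he.ne').1 h4

omit [IsUltrametricDist F] [IsUltrametricDist E] in
lemma norm_eq_rpow_vP {p q e f0 : ℕ} (hp : 1 < p) (hf0 : 0 < f0) (he : 0 < e) (hq : q = p ^ f0)
    (hpF : ‖(p : F)‖ = (q : ℝ) ^ (-(e : ℤ))) {x : E} (hx : x ≠ 0) :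
    ‖x‖ = ‖(p : F)‖ ^ vP p (e * f0) x := by
  have hp0 : (1 : ℝ) < p := by exact_mod_cast hp
  have hp1 : (0 : ℝ) < p := by linarith
  have h1 : ‖(p : F)‖ = (p : ℝ) ^ (-((e * f0 : ℕ) : ℝ)) := by
    rw [hpF, hq, Nat.cast_pow, zpow_neg, zpow_natCast, ← pow_mul, Real.rpow_neg hp1.le,
      Real.rpow_natCast, mul_comm]
  have h2 : ((e * f0 : ℕ) : ℝ) ≠ 0 := by positivity
  rw [h1, ← Real.rpow_mul hp1.le, vP, neg_div, neg_mul_neg, mul_div_cancel₀ _ h2,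
    Real.rpow_logb hp1 hp0.ne' (norm_pos_iff.2 hx)]

omit [IsUltrametricDist F] in
lemma hasTaylor_char {q : ℕ} {ϖ : F} (hq : 1 < q) (hϖ : ‖ϖ‖ = (q : ℝ)⁻¹) {emb : S → (F →+* E)}
    (hemb : ∀ σ z, ‖emb σ z‖ = ‖z‖) {J : Set S} (N : ℕ) {χ : F →* E} (hχ : IsLocJChar q emb J χ) :
    HasTaylor emb J N (fun _ => 0) (fun t => χ (1 + t)) := by
  obtain ⟨_, l, hl⟩ := hχ
  obtain ⟨c, hc, H⟩ := hl 1 norm_one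
  have hq0 : (0 : ℝ) < q := by positivity
  have hn : ‖ϖ ^ l‖ = (q : ℝ) ^ (-(l : ℤ)) := by
    rw [norm_pow, hϖ, zpow_neg, zpow_natCast, inv_pow]
  refine hasTaylor_of_hasSum hemb N (c := c) (fun m σ hσ hm => hc m fun h => hm.ne' (h σ hσ))
    (t₀ := ϖ ^ l) (norm_pos_iff.1 (by rw [hn]; positivity)) fun t ht => ?_
  have := H (1 + t) (by rwa [add_sub_cancel_left, ← hn])
  simpa only [add_sub_cancel_left] using this

end Characters

section Phi

/-- The function `χ2χ1⁻¹(w) w^{d-k} w^{-m}`, with value `0` at `0`. -/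
def phi (emb : S → (F →+* E)) (J : Set S) (d : S → ℕ) (χ1 χ2 : F →* E) (i : S → ℕ) (w : F) : E :=
  if w = 0 then 0 else chRatio χ1 χ2 w * negPow emb J d i w

variable {emb : S → (F →+* E)} {J : Set S} {d : S → ℕ} {χ1 χ2 : F →* E}

lemma lFun2_eq_phi (a : F) (i : S → ℕ) (z : F) :
    lFun2 emb J d χ1 χ2 a i z = phi emb J d χ1 χ2 i (z - a) := by
  simp only [lFun2, phi, sub_eq_zero]

lemma negPow_mul (i : S → ℕ) (x y : F) :
    negPow emb J d i (x * y) = negPow emb J d i x * negPow emb J d i y := by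
  simp only [negPow, map_mul, mul_pow, Finset.prod_mul_distrib]
  rw [mul_div_mul_comm]

lemma phi_mul (i : S → ℕ) (x y : F) :
    phi emb J d χ1 χ2 i (x * y) = phi emb J d χ1 χ2 i x * phi emb J d χ1 χ2 i y := by
  by_cases hx : x = 0
  · simp [phi, hx]
  by_cases hy : y = 0
  · simp [phi, hy]
  simp only [phi, mul_eq_zero, hx, hy, or_self, if_false, negPow_mul, chRatio, map_mul]
  rw [mul_div_mul_comm]
  ring

lemma phi_mul_mPow {i j : S → ℕ} (hi : ∀ σ, σ ∉ J → i σ ≤ d σ) (hj : ∀ σ, j σ ≤ i σ) (w : F) :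
    phi emb J d χ1 χ2 i w * mPow emb w j = phi emb J d χ1 χ2 (fun σ => i σ - j σ) w := by
  by_cases hw : w = 0
  · simp [phi, hw]
  have hne : ∀ σ, emb σ w ≠ 0 := fun σ => (map_ne_zero _).2 hw
  simp only [phi, hw, if_false, mul_assoc]
  congr 1
  have h1 : mPow emb w j = (∏ σ ∈ Finset.univ.filter (fun σ => σ ∉ J), (emb σ w) ^ (j σ)) *
      ∏ σ ∈ Finset.univ.filter (fun σ => σ ∈ J), (emb σ w) ^ (j σ) := by
    rw [mPow, ← Finset.prod_filter_mul_prod_filter_not Finset.univ (fun σ => σ ∈ J), mul_comm]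
  have h2 : (∏ σ ∈ Finset.univ.filter (fun σ => σ ∉ J), (emb σ w) ^ (d σ - (i σ - j σ))) =
      (∏ σ ∈ Finset.univ.filter (fun σ => σ ∉ J), (emb σ w) ^ (d σ - i σ)) *
      ∏ σ ∈ Finset.univ.filter (fun σ => σ ∉ J), (emb σ w) ^ (j σ) := by
    rw [← Finset.prod_mul_distrib]
    refine Finset.prod_congr rfl fun σ hσ => ?_
    rw [← pow_add]
    have := hi σ (Finset.mem_filter.1 hσ).2
    have := hj σ
    congr 1
    omega
  have h3 : (∏ σ ∈ Finset.univ.filter (fun σ => σ ∈ J), (emb σ w) ^ (i σ)) =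
      (∏ σ ∈ Finset.univ.filter (fun σ => σ ∈ J), (emb σ w) ^ (i σ - j σ)) *
      ∏ σ ∈ Finset.univ.filter (fun σ => σ ∈ J), (emb σ w) ^ (j σ) := by
    rw [← Finset.prod_mul_distrib]
    refine Finset.prod_congr rfl fun σ hσ => ?_
    rw [← pow_add, Nat.sub_add_cancel (hj σ)]
  have h4 : ∏ σ ∈ Finset.univ.filter (fun σ => σ ∈ J), (emb σ w) ^ (j σ) ≠ 0 :=
    Finset.prod_ne_zero_iff.2 fun σ _ => pow_ne_zero _ (hne σ)
  have h5 : ∏ σ ∈ Finset.univ.filter (fun σ => σ ∈ J), (emb σ w) ^ (i σ - j σ) ≠ 0 :=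
    Finset.prod_ne_zero_iff.2 fun σ _ => pow_ne_zero _ (hne σ)
  rw [negPow, negPow, h1, h2, h3]
  field_simp

lemma phi_mul_mPow_self {i : S → ℕ} (hi : ∀ σ, σ ∉ J → i σ ≤ d σ) {w : F} (hw : w ≠ 0) :
    phi emb J d χ1 χ2 i w * mPow emb w i = chRatio χ1 χ2 w * dPow emb J d w := by
  rw [phi_mul_mPow hi fun σ => le_rfl]
  simp [phi, hw, negPow, dPow]

lemma norm_negPow (hemb : ∀ σ z, ‖emb σ z‖ = ‖z‖) {i : S → ℕ} (hi : ∀ σ, σ ∉ J → i σ ≤ d σ)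
    {w : F} (hw : w ≠ 0) : ‖negPow emb J d i w‖ = ‖w‖ ^ ((dSum J d : ℝ) - mSum i) := by
  have hw' : 0 < ‖w‖ := norm_pos_iff.2 hw
  have h1 : mSum i = (∑ σ ∈ Finset.univ.filter (fun σ => σ ∉ J), i σ) +
      ∑ σ ∈ Finset.univ.filter (fun σ => σ ∈ J), i σ := by
    rw [mSum, ← Finset.sum_filter_add_sum_filter_not Finset.univ (fun σ => σ ∈ J), add_comm]
  have h2 : dSum J d = (∑ σ ∈ Finset.univ.filter (fun σ => σ ∉ J), (d σ - i σ)) +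
      ∑ σ ∈ Finset.univ.filter (fun σ => σ ∉ J), i σ := by
    rw [dSum, ← Finset.sum_add_distrib]
    exact Finset.sum_congr rfl fun σ hσ =>
      (Nat.sub_add_cancel (hi σ (Finset.mem_filter.1 hσ).2)).symm
  simp only [negPow, norm_div, norm_prod, norm_pow, hemb, Finset.prod_pow_eq_pow_sum]
  rw [h1, h2, ← Real.rpow_natCast, ← Real.rpow_natCast, ← Real.rpow_sub hw']
  push_cast
  congr 1
  ring

/-- Taylor expansion of `phi` around a nonzero point, uniform after rescaling. -/
lemma exists_phi_expansion [IsUltrametricDist F] [IsUltrametricDist E]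
    (hemb : ∀ σ z, ‖emb σ z‖ = ‖z‖) {N : ℕ}
    (h1 : HasTaylor emb J N (fun _ => 0) (fun t => χ1 (1 + t)))
    (h2 : HasTaylor emb J N (fun _ => 0) (fun t => χ2 (1 + t)))
    (hu : ∀ u : F, ‖u‖ = 1 → ‖χ1 u‖ = 1) (i : S → ℕ) :
    ∃ c : (S → ℕ) → E, (∀ m σ, σ ∉ J → d σ < m σ → c m = 0) ∧ ∃ δ : ℝ, 0 < δ ∧ δ < 1 ∧
      ∃ M : ℝ, 0 ≤ M ∧ ∀ w : F, w ≠ 0 → ∀ y : F, ‖y‖ ≤ δ * ‖w‖ →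
        ‖phi emb J d χ1 χ2 i (w + y) -
          ∑ m ∈ degLE S N, c m * phi emb J d χ1 χ2 i w / mPow emb w m * mPow emb y m‖ ≤
          M * ‖phi emb J d χ1 χ2 i w‖ * (‖y‖ / ‖w‖) ^ (N + 1) := by
  have hone : ∀ t : F, ‖t‖ < 1 → ‖1 + t‖ = 1 := fun t ht =>
    norm_eq_one_of_norm_sub_one_lt (by rwa [add_sub_cancel_left])
  have hden := (h1.mul hemb ((hasTaylor_prod emb J J N i).mono (b' := fun _ => 0)
    fun σ hσ => by simp [hσ])).inv hemb (by simp) (fun t ht => by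
      simp only [norm_mul, norm_prod, norm_pow, hemb, hone t ht, hu _ (hone t ht), one_pow,
        Finset.prod_const_one, mul_one])
  have hnum := (h2.mul hemb (hasTaylor_prod emb J Jᶜ N (fun σ => d σ - i σ))).mul hemb hden
  obtain ⟨c, hc, δ, hδ, M, hM, H⟩ := (hnum.mono (b' := d) (by
    intro σ hσ
    simp [hσ])).exists_coeff hemb
  refine ⟨c, hc, min δ (1 / 2), by positivity, (min_le_right _ _).trans_lt (by norm_num), M, hM, ?_⟩
  intro w hw y hy
  have hw' : 0 < ‖w‖ := norm_pos_iff.2 hw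
  have ht : ‖y / w‖ ≤ min δ (1 / 2) := by rwa [norm_div, div_le_iff₀ hw']
  have ht1 : ‖y / w‖ < 1 := (ht.trans (min_le_right _ _)).trans_lt (by norm_num)
  have h3 := H (y / w) (ht.trans (min_le_left _ _))
  have hne : (1 + y / w) ≠ 0 := norm_ne_zero_iff.1 (by rw [hone _ ht1]; exact one_ne_zero)
  have h4 : phi emb J d χ1 χ2 i (1 + y / w) = χ2 (1 + y / w) *
      (∏ σ ∈ Finset.univ.filter (fun σ => σ ∈ Jᶜ), (emb σ (1 + y / w)) ^ (d σ - i σ)) *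
      (χ1 (1 + y / w) * ∏ σ ∈ Finset.univ.filter (fun σ => σ ∈ J), (emb σ (1 + y / w)) ^ i σ)⁻¹ := by
    simp only [phi, hne, if_false, chRatio, negPow, Set.mem_compl_iff]
    rw [mul_inv, div_eq_mul_inv, div_eq_mul_inv]
    ring
  replace h3 : ‖phi emb J d χ1 χ2 i (1 + y / w) - ∑ m ∈ degLE S N, c m * mPow emb (y / w) m‖ ≤
      M * ‖y / w‖ ^ (N + 1) := by
    rw [h4]
    convert h3
  have h5 : w + y = w * (1 + y / w) := by rw [mul_add, mul_one, mul_div_cancel₀ _ hw]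
  have h6 : phi emb J d χ1 χ2 i (w + y) -
      ∑ m ∈ degLE S N, c m * phi emb J d χ1 χ2 i w / mPow emb w m * mPow emb y m =
      phi emb J d χ1 χ2 i w * (phi emb J d χ1 χ2 i (1 + y / w) -
        ∑ m ∈ degLE S N, c m * mPow emb (y / w) m) := by
    rw [h5, phi_mul, mul_sub, Finset.mul_sum]
    congr 1
    refine Finset.sum_congr rfl fun m _ => ?_
    rw [mPow_div]
    ring
  rw [h6, norm_mul, ← norm_div, mul_comm M, mul_assoc]
  exact mul_le_mul_of_nonneg_left h3 (norm_nonneg _)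

end Phi

section CrBound

/-- `f` lies in `C^r(O_F, J, d)`, with derivative data and scaled remainder bounded by `B`. -/
def CrBd (q : ℕ) (emb : S → (F →+* E)) (r : ℝ) (J : Set S) (d : S → ℕ) (f : F → E) (B : ℝ) :
    Prop :=
  ∃ Df, IsCrWith q emb r f Df ∧
    (∀ σ : S, σ ∉ J → ∀ x : F, ‖x‖ ≤ 1 → Df (Pi.single σ (d σ + 1)) x = 0) ∧
    (∀ i, mSum i ≤ ⌊r⌋₊ → ∀ z : F, ‖z‖ ≤ 1 → ‖Df i z / (mFact i : E)‖ ≤ B) ∧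
    ∀ z y : F, ‖z‖ ≤ 1 → ‖y‖ ≤ 1 → y ≠ 0 → ‖crRem emb ⌊r⌋₊ f Df z y‖ ≤ B * ‖y‖ ^ r

variable {q : ℕ} {emb : S → (F →+* E)} {r : ℝ} {J : Set S} {d : S → ℕ} {f g : F → E} {B : ℝ}

lemma crRem_add (N : ℕ) (f g : F → E) (Df Dg : (S → ℕ) → F → E) (x y : F) :
    crRem emb N (fun z => f z + g z) (fun i z => Df i z + Dg i z) x y =
      crRem emb N f Df x y + crRem emb N g Dg x y := by
  simp only [crRem, add_mul, add_div, Finset.sum_add_distrib]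
  ring

lemma crRem_const_mul (N : ℕ) (c : E) (f : F → E) (Df : (S → ℕ) → F → E) (x y : F) :
    crRem emb N (fun z => c * f z) (fun i z => c * Df i z) x y = c * crRem emb N f Df x y := by
  simp only [crRem, mul_sub, Finset.mul_sum, mul_assoc, mul_div_assoc]

lemma IsCrWith.add {Df Dg : (S → ℕ) → F → E} (hf : IsCrWith q emb r f Df)
    (hg : IsCrWith q emb r g Dg) :
    IsCrWith q emb r (fun z => f z + g z) (fun i z => Df i z + Dg i z) := by
  refine ⟨fun i hi => ?_, fun ε hε => ?_⟩
  · obtain ⟨C, hC⟩ := hf.1 i hi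
    obtain ⟨C', hC'⟩ := hg.1 i hi
    exact ⟨C + C', fun x hx => (norm_add_le _ _).trans (add_le_add (hC x hx) (hC' x hx))⟩
  · obtain ⟨H, hH⟩ := hf.2 (ε / 2) (half_pos hε)
    obtain ⟨H', hH'⟩ := hg.2 (ε / 2) (half_pos hε)
    refine ⟨max H H', fun h hh x y hx hy => ?_⟩
    have h1 := hH h ((le_max_left _ _).trans hh) x y hx hy
    have h2 := hH' h ((le_max_right _ _).trans hh) x y hx hy
    rw [crRem_add]
    calc _ ≤ (‖crRem emb ⌊r⌋₊ f Df x y‖ + ‖crRem emb ⌊r⌋₊ g Dg x y‖) * (q : ℝ) ^ (r * (h : ℝ)) :=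
          mul_le_mul_of_nonneg_right (norm_add_le _ _) (by positivity)
      _ ≤ ε := by rw [add_mul]; linarith

lemma IsCrWith.const_mul {Df : (S → ℕ) → F → E} (c : E) (hf : IsCrWith q emb r f Df) :
    IsCrWith q emb r (fun z => c * f z) (fun i z => c * Df i z) := by
  refine ⟨fun i hi => ?_, fun ε hε => ?_⟩
  · obtain ⟨C, hC⟩ := hf.1 i hi
    exact ⟨‖c‖ * C, fun x hx => by
      rw [norm_mul]; exact mul_le_mul_of_nonneg_left (hC x hx) (norm_nonneg _)⟩
  · obtain ⟨H, hH⟩ := hf.2 (ε / (‖c‖ + 1)) (by positivity)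
    refine ⟨H, fun h hh x y hx hy => ?_⟩
    have h1 := hH h hh x y hx hy
    rw [crRem_const_mul, norm_mul, mul_assoc]
    calc _ ≤ (‖c‖ + 1) * (ε / (‖c‖ + 1)) :=
          mul_le_mul (by linarith) h1 (by positivity) (by positivity)
      _ = ε := by field_simp

lemma CrBd.isCrJ (h : CrBd q emb r J d f B) : IsCrJ q emb r J d f := by
  obtain ⟨Df, h1, h2, _⟩ := h
  exact ⟨Df, h1, h2⟩

lemma CrBd.mono {B' : ℝ} (h : CrBd q emb r J d f B) (hB : B ≤ B') : CrBd q emb r J d f B' := by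
  obtain ⟨Df, h1, h2, h3, h4⟩ := h
  exact ⟨Df, h1, h2, fun i hi z hz => (h3 i hi z hz).trans hB, fun z y hz hy hy0 =>
    (h4 z y hz hy hy0).trans (mul_le_mul_of_nonneg_right hB (by positivity))⟩

lemma CrBd.congr [IsUltrametricDist F] (hq : 1 < q) (h : CrBd q emb r J d f B)
    (hfg : ∀ z : F, ‖z‖ ≤ 1 → g z = f z) : CrBd q emb r J d g B := by
  obtain ⟨Df, ⟨h0, h1⟩, h2, h3, h4⟩ := h
  have key : ∀ x y : F, ‖x‖ ≤ 1 → ‖y‖ ≤ 1 →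
      crRem emb ⌊r⌋₊ g Df x y = crRem emb ⌊r⌋₊ f Df x y := fun x y hx hy => by
    rw [crRem, crRem, hfg (x + y) ((IsUltrametricDist.norm_add_le_max x y).trans (max_le hx hy))]
  refine ⟨Df, ⟨h0, fun ε hε => ?_⟩, h2, h3, fun z y hz hy hy0 => ?_⟩
  · obtain ⟨H, hH⟩ := h1 ε hε
    refine ⟨H, fun h hh x y hx hy => ?_⟩
    rw [key x y hx (hy.trans (zpow_le_one_of_nonpos₀ (by exact_mod_cast hq.le) (by simp)))]
    exact hH h hh x y hx hy
  · rw [key z y hz hy]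
    exact h4 z y hz hy hy0

lemma CrBd.zero (hB : 0 ≤ B) : CrBd q emb r J d (fun _ : F => (0 : E)) B := by
  have h0 : ∀ x y : F, crRem emb ⌊r⌋₊ (fun _ : F => (0 : E)) (fun _ _ => 0) x y = 0 := by
    simp [crRem]
  refine ⟨fun _ _ => 0, ⟨fun i _ => ⟨0, by simp⟩, fun ε hε => ⟨0, fun h _ x y _ _ => ?_⟩⟩,
    by simp, by simpa using fun _ _ _ _ => hB, fun z y _ _ _ => ?_⟩
  · rw [h0]; simpa using hε.le
  · rw [h0, norm_zero]; positivity

lemma CrBd.add [IsUltrametricDist E] (hf : CrBd q emb r J d f B) (hg : CrBd q emb r J d g B) :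
    CrBd q emb r J d (fun z => f z + g z) B := by
  obtain ⟨Df, h1, h2, h3, h4⟩ := hf
  obtain ⟨Dg, h1', h2', h3', h4'⟩ := hg
  refine ⟨_, h1.add h1', fun σ hσ x hx => ?_, fun i hi z hz => ?_, fun z y hz hy hy0 => ?_⟩
  · simp only [h2 σ hσ x hx, h2' σ hσ x hx, add_zero]
  · rw [add_div]
    exact (IsUltrametricDist.norm_add_le_max _ _).trans (max_le (h3 i hi z hz) (h3' i hi z hz))
  · rw [crRem_add]
    exact (IsUltrametricDist.norm_add_le_max _ _).trans
      (max_le (h4 z y hz hy hy0) (h4' z y hz hy hy0))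

lemma CrBd.const_mul (c : E) (hf : CrBd q emb r J d f B) :
    CrBd q emb r J d (fun z => c * f z) (‖c‖ * B) := by
  obtain ⟨Df, h1, h2, h3, h4⟩ := hf
  refine ⟨_, h1.const_mul c, fun σ hσ x hx => ?_, fun i hi z hz => ?_, fun z y hz hy hy0 => ?_⟩
  · simp only [h2 σ hσ x hx, mul_zero]
  · rw [mul_div_assoc, norm_mul]
    exact mul_le_mul_of_nonneg_left (h3 i hi z hz) (norm_nonneg _)
  · rw [crRem_const_mul, norm_mul, mul_assoc]
    exact mul_le_mul_of_nonneg_left (h4 z y hz hy hy0) (norm_nonneg _)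

lemma CrBd.sum [IsUltrametricDist E] {ι : Type*} (s : Finset ι) {f : ι → F → E} (hB : 0 ≤ B)
    (h : ∀ j ∈ s, CrBd q emb r J d (f j) B) : CrBd q emb r J d (fun z => ∑ j ∈ s, f j z) B := by
  induction s using Finset.induction_on with
  | empty => simpa using CrBd.zero hB
  | insert a s ha ih =>
    simp only [Finset.sum_insert ha]
    exact (h a (Finset.mem_insert_self _ _)).add
      (ih fun j hj => h j (Finset.mem_insert_of_mem hj))

/-- The set defining the `C^r` norm is bounded. -/
lemma IsCrWith.bddAbove [IsUltrametricDist F] (hq : 1 < q) (hr : 0 ≤ r)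
    (hval : ∀ x : F, x ≠ 0 → ∃ n : ℤ, ‖x‖ = (q : ℝ) ^ n) (hemb : ∀ σ z, ‖emb σ z‖ = ‖z‖)
    {Df : (S → ℕ) → F → E} (hf : IsCrWith q emb r f Df) :
    BddAbove ({x | ∃ i : S → ℕ, mSum i ≤ ⌊r⌋₊ ∧ ∃ z : F, ‖z‖ ≤ 1 ∧
          x = ‖Df i z / (mFact i : E)‖} ∪
        {x | ∃ z y : F, ‖z‖ ≤ 1 ∧ ‖y‖ ≤ 1 ∧ y ≠ 0 ∧
          x = ‖crRem emb ⌊r⌋₊ f Df z y‖ / ‖y‖ ^ r}) := by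
  have hq1 : (1 : ℝ) < q := by exact_mod_cast hq
  have hq0 : (0 : ℝ) < q := by linarith
  have hD : ∀ i : S → ℕ, ∃ C : ℝ, 0 ≤ C ∧
      (mSum i ≤ ⌊r⌋₊ → ∀ z : F, ‖z‖ ≤ 1 → ‖Df i z / (mFact i : E)‖ ≤ C) := fun i => by
    by_cases hi : mSum i ≤ ⌊r⌋₊
    · obtain ⟨C, hC⟩ := hf.1 i hi
      have hC0 : 0 ≤ C := (norm_nonneg _).trans (hC 0 (by simp))
      refine ⟨C / ‖(mFact i : E)‖, by positivity, fun _ z hz => ?_⟩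
      rw [norm_div]
      exact div_le_div_of_nonneg_right (hC z hz) (norm_nonneg _)
    · exact ⟨0, le_rfl, fun h => absurd h hi⟩
  choose C hC0 hC using hD
  set K : ℝ := ∑ i ∈ degLE S ⌊r⌋₊, C i with hK
  have hK0 : 0 ≤ K := Finset.sum_nonneg fun i _ => hC0 i
  have hKi : ∀ i, mSum i ≤ ⌊r⌋₊ → ∀ z : F, ‖z‖ ≤ 1 → ‖Df i z / (mFact i : E)‖ ≤ K :=
    fun i hi z hz => (hC i hi z hz).trans
      (Finset.single_le_sum (f := C) (fun i _ => hC0 i) (mem_degLE.2 hi))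
  obtain ⟨H, hH⟩ := hf.2 1 one_pos
  have hf0 : ∀ x : F, ‖x‖ ≤ 1 → ‖f x‖ ≤ 1 + K := by
    intro x hx
    have h1 := hH H le_rfl x 0 hx (by rw [norm_zero]; positivity)
    have h2 : ‖crRem emb ⌊r⌋₊ f Df x 0‖ ≤ 1 := by
      refine le_trans ?_ h1
      exact le_mul_of_one_le_right (norm_nonneg _) (Real.one_le_rpow hq1.le (by positivity))
    have h3 : f x = crRem emb ⌊r⌋₊ f Df x 0 +
        ∑ i ∈ degLE S ⌊r⌋₊, Df i x * mPow emb 0 i / (mFact i : E) := by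
      simp [crRem]
    rw [h3]
    refine (norm_add_le _ _).trans (add_le_add h2 ((norm_sum_le _ _).trans ?_))
    refine Finset.sum_le_sum fun i hi => ?_
    rw [mul_div_right_comm, norm_mul, norm_mPow hemb]
    refine (mul_le_of_le_one_right (norm_nonneg _) (pow_le_one₀ (by simp) (by simp))).trans
      (hC i (mem_degLE.1 hi) x hx)
  have hrem : ∀ x y : F, ‖x‖ ≤ 1 → ‖y‖ ≤ 1 → ‖crRem emb ⌊r⌋₊ f Df x y‖ ≤ 1 + K + K := by
    intro x y hx hy
    rw [crRem]
    refine (norm_sub_le _ _).trans (add_le_add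
      (hf0 _ ((IsUltrametricDist.norm_add_le_max x y).trans (max_le hx hy)))
      ((norm_sum_le _ _).trans (Finset.sum_le_sum fun i hi => ?_)))
    rw [mul_div_right_comm, norm_mul, norm_mPow hemb]
    exact (mul_le_of_le_one_right (norm_nonneg _) (pow_le_one₀ (norm_nonneg _) hy)).trans
      (hC i (mem_degLE.1 hi) x hx)
  refine ⟨max K (max 1 ((1 + K + K) * (q : ℝ) ^ (r * H))), ?_⟩
  rintro x (⟨i, hi, z, hz, rfl⟩ | ⟨z, y, hz, hy, hy0, rfl⟩)
  · exact (hKi i hi z hz).trans (le_max_left _ _)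
  · refine le_trans ?_ (le_max_right _ _)
    obtain ⟨n, hn⟩ := hval y hy0
    have hn0 : n ≤ 0 := by
      by_contra hlt
      exact absurd hy (not_le.2 (hn ▸ one_lt_zpow₀ hq1 (not_le.1 hlt)))
    obtain ⟨h, rfl⟩ : ∃ h : ℕ, n = -(h : ℤ) := ⟨n.natAbs, by omega⟩
    have hyr : (‖y‖ ^ r)⁻¹ = (q : ℝ) ^ (r * (h : ℝ)) := by
      rw [hn, ← Real.rpow_intCast, ← Real.rpow_mul hq0.le, ← Real.rpow_neg hq0.le]
      congr 1
      push_cast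
      ring
    rw [div_eq_mul_inv, hyr]
    rcases le_total H h with hh | hh
    · exact (hH h hh z y hz hn.le).trans (le_max_left _ _)
    · refine le_trans ?_ (le_max_right _ _)
      refine mul_le_mul (hrem z y hz hy) ?_ (by positivity) (by positivity)
      exact Real.rpow_le_rpow_of_exponent_le hq1.le
        (mul_le_mul_of_nonneg_left (by exact_mod_cast hh) hr)

/-- Any bounded derivative data bounds the `C^r` norm. -/
lemma CrBd.crNorm_le [IsUltrametricDist F] [CharZero E] (hq : 1 < q) (hr : 0 ≤ r)
    (hval : ∀ x : F, x ≠ 0 → ∃ n : ℤ, ‖x‖ = (q : ℝ) ^ n) (hemb : ∀ σ z, ‖emb σ z‖ = ‖z‖)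
    (hE : ∃ t : E, 1 < ‖t‖) (hB : 0 ≤ B) (hf : CrBd q emb r J d f B) :
    crNorm q emb r f ≤ B := by
  obtain ⟨D₀, h1, _, h3, h4⟩ := hf
  rw [crNorm]
  by_cases hbdd : BddAbove {c | ∃ Df, IsCrWith q emb r f Df ∧ c = crNormWith emb r f Df}
  swap
  · rw [Real.sSup_of_not_bddAbove hbdd]
    exact hB
  obtain ⟨K, hK⟩ := hbdd
  refine Real.sSup_le ?_ hB
  rintro _ ⟨Df, hDf, rfl⟩
  have huniq : ∀ i, mSum i ≤ ⌊r⌋₊ → ∀ z : F, ‖z‖ ≤ 1 → Df i z = D₀ i z := by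
    intro i hi z hz
    by_contra hne
    obtain ⟨t, ht⟩ := hE
    have hfac : (mFact i : E) ≠ 0 := by
      rw [Nat.cast_ne_zero]
      exact Finset.prod_ne_zero_iff.2 fun σ _ => Nat.factorial_ne_zero _
    have hv : 0 < ‖(Df i z - D₀ i z) / (mFact i : E)‖ :=
      norm_pos_iff.2 (div_ne_zero (sub_ne_zero.2 hne) hfac)
    obtain ⟨k, hk⟩ := pow_unbounded_of_one_lt
      ((K + ‖D₀ i z / (mFact i : E)‖) / ‖(Df i z - D₀ i z) / (mFact i : E)‖) ht
    rw [div_lt_iff₀ hv, ← norm_pow, ← norm_mul] at hk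
    have hDt : IsCrWith q emb r f (fun j x => (1 - t ^ k) * D₀ j x + t ^ k * Df j x) := by
      have := (h1.const_mul (1 - t ^ k)).add (hDf.const_mul (t ^ k))
      have hfe : (fun z => (1 - t ^ k) * f z + t ^ k * f z) = f := by
        funext z; ring
      rwa [hfe] at this
    have hle := hK ⟨_, hDt, rfl⟩
    have hge : ‖((1 - t ^ k) * D₀ i z + t ^ k * Df i z) / (mFact i : E)‖ ≤
        crNormWith emb r f (fun j x => (1 - t ^ k) * D₀ j x + t ^ k * Df j x) :=
      le_csSup (hDt.bddAbove hq hr hval hemb) (Or.inl ⟨i, hi, z, hz, rfl⟩)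
    have heq : t ^ k * ((Df i z - D₀ i z) / (mFact i : E)) =
        ((1 - t ^ k) * D₀ i z + t ^ k * Df i z) / (mFact i : E) - D₀ i z / (mFact i : E) := by
      field_simp
      ring
    rw [heq] at hk
    have := norm_sub_le (((1 - t ^ k) * D₀ i z + t ^ k * Df i z) / (mFact i : E))
      (D₀ i z / (mFact i : E))
    linarith
  refine Real.sSup_le ?_ hB
  rintro _ (⟨i, hi, z, hz, rfl⟩ | ⟨z, y, hz, hy, hy0, rfl⟩)
  · rw [huniq i hi z hz]
    exact h3 i hi z hz
  · have heq : crRem emb ⌊r⌋₊ f Df z y = crRem emb ⌊r⌋₊ f D₀ z y := by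
      rw [crRem, crRem]
      congr 1
      exact Finset.sum_congr rfl fun i hi => by rw [huniq i (mem_degLE.1 hi) z hz]
    rw [heq, div_le_iff₀ (Real.rpow_pos_of_pos (norm_pos_iff.2 hy0) _)]
    exact h4 z y hz hy hy0

/-- Functions of class `C^r` are continuous at `0` along powers of `ϖ`. -/
lemma IsCrWith.tendsto_zero (hq : 1 < q) (hr : 0 ≤ r) {ϖ : F} (hϖ : ‖ϖ‖ = (q : ℝ)⁻¹)
    (hemb : ∀ σ z, ‖emb σ z‖ = ‖z‖) {Df : (S → ℕ) → F → E} (hf : IsCrWith q emb r f Df) :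
    Tendsto (fun h : ℕ => f (ϖ ^ h)) atTop (𝓝 (f 0)) := by
  have hq1 : (1 : ℝ) < q := by exact_mod_cast hq
  have hcont : ∀ σ, Continuous (emb σ) := fun σ =>
    (AddMonoidHomClass.isometry_of_norm (emb σ) (hemb σ)).continuous
  have hbound : ∀ ε : ℝ, 0 < ε → ∃ H : ℕ, ∀ h : ℕ, H ≤ h → ∀ y : F, ‖y‖ ≤ (q : ℝ) ^ (-(h : ℤ)) →
      ‖crRem emb ⌊r⌋₊ f Df 0 y‖ ≤ ε := by
    intro ε hε
    obtain ⟨H, hH⟩ := hf.2 ε hε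
    refine ⟨H, fun h hh y hy => le_trans ?_ (hH h hh 0 y (by simp) hy)⟩
    exact le_mul_of_one_le_right (norm_nonneg _) (Real.one_le_rpow hq1.le (by positivity))
  have h0 : crRem emb ⌊r⌋₊ f Df 0 0 = 0 := by
    rw [← norm_le_zero_iff]
    refine le_of_forall_pos_le_add fun ε hε => ?_
    obtain ⟨H, hH⟩ := hbound ε hε
    rw [zero_add]
    exact hH H le_rfl 0 (by rw [norm_zero]; positivity)
  have h1 : Tendsto (fun h : ℕ => crRem emb ⌊r⌋₊ f Df 0 (ϖ ^ h)) atTop (𝓝 0) := by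
    rw [Metric.tendsto_atTop]
    intro ε hε
    obtain ⟨H, hH⟩ := hbound (ε / 2) (half_pos hε)
    refine ⟨H, fun h hh => ?_⟩
    rw [dist_zero_right]
    refine (hH h hh (ϖ ^ h) ?_).trans_lt (half_lt_self hε)
    rw [norm_pow, hϖ, zpow_neg, zpow_natCast, inv_pow]
  have hpow : Tendsto (fun h : ℕ => ϖ ^ h) atTop (𝓝 0) :=
    tendsto_pow_atTop_nhds_zero_of_norm_lt_one (by rw [hϖ]; exact inv_lt_one_of_one_lt₀ hq1)
  have h2 : Continuous fun y : F =>
      ∑ i ∈ degLE S ⌊r⌋₊, Df i 0 * mPow emb y i / (mFact i : E) := by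
    unfold mPow
    fun_prop
  have h3 := h1.add ((h2.tendsto 0).comp hpow)
  have h4 : 0 + ∑ i ∈ degLE S ⌊r⌋₊, Df i 0 * mPow emb 0 i / (mFact i : E) = f 0 := by
    rw [crRem, add_zero, sub_eq_zero] at h0
    rw [zero_add, ← h0]
  rw [h4] at h3
  refine h3.congr fun h => ?_
  simp [crRem]

lemma BNorm_le [IsUltrametricDist F] [CharZero E] (hq : 1 < q) (hr : 0 ≤ r)
    {ϖ : F} (hϖ : ‖ϖ‖ = (q : ℝ)⁻¹)
    (hval : ∀ x : F, x ≠ 0 → ∃ n : ℤ, ‖x‖ = (q : ℝ) ^ n) (hemb : ∀ σ z, ‖emb σ z‖ = ‖z‖)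
    (hE : ∃ t : E, 1 < ‖t‖) (hB : 0 ≤ B) {χ1 χ2 : F →* E}
    (hf : CrBd q emb r J d (fun z => f (ϖ * z)) B) (hg : CrBd q emb r J d g B)
    (hfg : ExtProp emb J d χ1 χ2 f g) : BNorm q emb r J d χ1 χ2 ϖ f ≤ B := by
  have hq1 : (1 : ℝ) < q := by exact_mod_cast hq
  refine Real.sSup_le ?_ hB
  rintro _ ⟨g', ⟨Dg', hg', _⟩, hfg', rfl⟩
  have hagree : ∀ z : F, z ≠ 0 → ‖z‖ ≤ 1 → g' z = g z := fun z hz hz1 => by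
    rw [hfg' z hz hz1, hfg z hz hz1]
  have hzero : g' 0 = g 0 := by
    obtain ⟨Dg, hDg, _⟩ := id hg
    refine tendsto_nhds_unique ((hg'.tendsto_zero hq hr hϖ hemb).congr fun h => ?_)
      (hDg.tendsto_zero hq hr hϖ hemb)
    have hn : ‖ϖ ^ h‖ = ((q : ℝ)⁻¹) ^ h := by rw [norm_pow, hϖ]
    refine hagree _ (norm_pos_iff.1 (by rw [hn]; positivity)) ?_
    rw [hn]
    exact pow_le_one₀ (by positivity) (inv_le_one_of_one_le₀ hq1.le)
  refine max_le (hf.crNorm_le hq hr hval hemb hE hB)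
    ((hg.congr hq fun z hz => ?_).crNorm_le hq hr hval hemb hE hB)
  by_cases h0 : z = 0
  · rw [h0, hzero]
  · exact hagree z h0 hz

end CrBound

section Cutoff

/-- The translate by `a` of `φ`, cut off to the closed disk of radius `R` around `a`. -/
def cutoff (φ : F → E) (a : F) (R : ℝ) (z : F) : E := if ‖z - a‖ ≤ R then φ (z - a) else 0

/-- Derivative data for `cutoff φ a R`, built from scaled Taylor coefficients `c` of `φ`. -/
def cutoffDeriv (emb : S → (F →+* E)) (c : (S → ℕ) → E) (φ : F → E) (a : F) (R : ℝ)
    (m : S → ℕ) (x : F) : E :=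
  mFact m * cutoff (fun w => c m * φ w / mPow emb w m) a R x

variable {emb : S → (F →+* E)} {φ : F → E} {s : ℝ}

lemma mFact_cast_ne_zero [CharZero E] (m : S → ℕ) : (mFact m : E) ≠ 0 := by
  rw [Nat.cast_ne_zero]
  exact Finset.prod_ne_zero_iff.2 fun σ _ => Nat.factorial_ne_zero _

lemma cutoffDeriv_div [CharZero E] (c : (S → ℕ) → E) (a : F) (R : ℝ) (m : S → ℕ) (x : F) :
    cutoffDeriv emb c φ a R m x / (mFact m : E) =
      cutoff (fun w => c m * φ w / mPow emb w m) a R x := by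
  rw [cutoffDeriv, mul_div_cancel_left₀ _ (mFact_cast_ne_zero m)]

lemma crRem_cutoff [CharZero E] (N : ℕ) (c : (S → ℕ) → E) (a : F) (R : ℝ) (x y : F) :
    crRem emb N (cutoff φ a R) (cutoffDeriv emb c φ a R) x y =
      cutoff φ a R (x + y) - if ‖x - a‖ ≤ R then
        ∑ m ∈ degLE S N, c m * φ (x - a) / mPow emb (x - a) m * mPow emb y m else 0 := by
  rw [crRem]
  congr 1
  split_ifs with h
  · refine Finset.sum_congr rfl fun m _ => ?_
    rw [mul_div_right_comm, cutoffDeriv_div, cutoff, if_pos h]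
  · refine Finset.sum_eq_zero fun m _ => ?_
    rw [mul_div_right_comm, cutoffDeriv_div, cutoff, if_neg h, zero_mul]

lemma norm_mul_pow_div_le (hemb : ∀ σ z, ‖emb σ z‖ = ‖z‖) (hφ : ∀ w ≠ 0, ‖φ w‖ = ‖w‖ ^ s)
    (hφ0 : φ 0 = 0) {R T ρ : ℝ} {m : S → ℕ} (hT : 0 ≤ T) (hmρ : (mSum m : ℝ) ≤ ρ) (hρs : ρ ≤ s)
    {w : F} (hwR : ‖w‖ ≤ R) (hwT : ‖w‖ ≤ T) :
    ‖φ w / mPow emb w m‖ * T ^ mSum m ≤ R ^ (s - ρ) * T ^ ρ := by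
  have hR : 0 ≤ R := (norm_nonneg w).trans hwR
  by_cases hw : w = 0
  · rw [hw, hφ0, zero_div, norm_zero, zero_mul]
    positivity
  have hw' : 0 < ‖w‖ := norm_pos_iff.2 hw
  have hT' : 0 < T := hw'.trans_le hwT
  rw [norm_div, hφ w hw, norm_mPow hemb, ← Real.rpow_natCast, ← Real.rpow_sub hw',
    ← Real.rpow_natCast]
  calc ‖w‖ ^ (s - mSum m) * T ^ (mSum m : ℝ)
      = ‖w‖ ^ (s - ρ) * (‖w‖ ^ (ρ - mSum m) * T ^ (mSum m : ℝ)) := by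
        rw [← mul_assoc, ← Real.rpow_add hw']
        congr 2
        ring
    _ ≤ R ^ (s - ρ) * (T ^ (ρ - mSum m) * T ^ (mSum m : ℝ)) := by
        have := Real.rpow_le_rpow hw'.le hwR (sub_nonneg.2 hρs)
        have := Real.rpow_le_rpow hw'.le hwT (sub_nonneg.2 hmρ)
        gcongr
    _ = R ^ (s - ρ) * T ^ ρ := by
        rw [← Real.rpow_add hT']
        congr 2
        ring

lemma norm_crRem_cutoff_le [IsUltrametricDist F] [CharZero E]
    (hemb : ∀ σ z, ‖emb σ z‖ = ‖z‖) (hφ : ∀ w ≠ 0, ‖φ w‖ = ‖w‖ ^ s) (hφ0 : φ 0 = 0) {N : ℕ}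
    {c : (S → ℕ) → E} {δ M : ℝ} (hδ : 0 < δ) (hδ1 : δ < 1) (hM : 0 ≤ M)
    (hexp : ∀ w : F, w ≠ 0 → ∀ y : F, ‖y‖ ≤ δ * ‖w‖ →
      ‖φ (w + y) - ∑ m ∈ degLE S N, c m * φ w / mPow emb w m * mPow emb y m‖ ≤
        M * ‖φ w‖ * (‖y‖ / ‖w‖) ^ (N + 1))
    {ρ : ℝ} (hNρ : (N : ℝ) ≤ ρ) (hρN : ρ ≤ N + 1) (hρs : ρ ≤ s)
    (a : F) {R : ℝ} (hR : 0 ≤ R) (x y : F) :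
    ‖crRem emb N (cutoff φ a R) (cutoffDeriv emb c φ a R) x y‖ ≤
      (M + (1 + ∑ m ∈ degLE S N, ‖c m‖) * (δ⁻¹) ^ ρ) * R ^ (s - ρ) * ‖y‖ ^ ρ := by
  have hρ0 : 0 ≤ ρ := (Nat.cast_nonneg N).trans hNρ
  set A : ℝ := ∑ m ∈ degLE S N, ‖c m‖ with hA
  have hA0 : 0 ≤ A := Finset.sum_nonneg fun _ _ => norm_nonneg _
  have hδi : (1 : ℝ) ≤ δ⁻¹ := (one_lt_inv₀ hδ).2 hδ1 |>.le
  set T : ℝ := δ⁻¹ * ‖y‖ with hT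
  have hyT : ‖y‖ ≤ T := le_mul_of_one_le_left (norm_nonneg _) hδi
  have hT0 : 0 ≤ T := (norm_nonneg _).trans hyT
  have hTρ : T ^ ρ = (δ⁻¹) ^ ρ * ‖y‖ ^ ρ := Real.mul_rpow (by positivity) (norm_nonneg _)
  have hval : ∀ w : F, ‖w‖ ≤ R → ‖w‖ ≤ T → ‖φ w‖ ≤ R ^ (s - ρ) * T ^ ρ := fun w hwR hwT => by
    simpa [mPow, mSum] using
      norm_mul_pow_div_le (m := fun _ : S => 0) hemb hφ hφ0 hT0 (by simpa [mSum] using hρ0) hρs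
        hwR hwT
  have hsplit : (M + (1 + A) * (δ⁻¹) ^ ρ) * R ^ (s - ρ) * ‖y‖ ^ ρ =
      M * (R ^ (s - ρ) * ‖y‖ ^ ρ) + R ^ (s - ρ) * T ^ ρ + A * (R ^ (s - ρ) * T ^ ρ) := by
    rw [hTρ]; ring
  have hP1 : 0 ≤ R ^ (s - ρ) * ‖y‖ ^ ρ := by positivity
  have hP2 : 0 ≤ R ^ (s - ρ) * T ^ ρ := by positivity
  have hMP1 : 0 ≤ M * (R ^ (s - ρ) * ‖y‖ ^ ρ) := by positivity
  have hAP2 : 0 ≤ A * (R ^ (s - ρ) * T ^ ρ) := by positivity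
  rw [hsplit, crRem_cutoff]
  by_cases hx : ‖x - a‖ ≤ R
  · rw [if_pos hx]
    by_cases hxy : x - a ≠ 0 ∧ ‖y‖ ≤ δ * ‖x - a‖
    · obtain ⟨hw, hy⟩ := hxy
      have hw' : 0 < ‖x - a‖ := norm_pos_iff.2 hw
      have hyw : ‖y‖ ≤ ‖x - a‖ := hy.trans (mul_le_of_le_one_left hw'.le hδ1.le)
      have hadd : x + y - a = x - a + y := by ring
      have hin : ‖x + y - a‖ ≤ R := by
        rw [hadd]
        exact (IsUltrametricDist.norm_add_le_max _ _).trans (max_le hx (hyw.trans hx))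
      rw [cutoff, if_pos hin, hadd]
      refine (hexp _ hw y hy).trans ?_
      have h1 : (‖y‖ / ‖x - a‖) ^ (N + 1) ≤ (‖y‖ / ‖x - a‖) ^ ρ := by
        rw [← Real.rpow_natCast]
        push_cast
        by_cases hy0 : ‖y‖ = 0
        · rw [hy0, zero_div, Real.zero_rpow (by positivity)]
          positivity
        · exact Real.rpow_le_rpow_of_exponent_ge (div_pos (lt_of_le_of_ne (norm_nonneg _)
            (Ne.symm hy0)) hw') ((div_le_one hw').2 hyw) hρN
      have h2 : M * ‖φ (x - a)‖ * (‖y‖ / ‖x - a‖) ^ (N + 1) ≤ M * (R ^ (s - ρ) * ‖y‖ ^ ρ) := by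
        rw [mul_assoc]
        refine mul_le_mul_of_nonneg_left ?_ hM
        calc ‖φ (x - a)‖ * (‖y‖ / ‖x - a‖) ^ (N + 1)
            ≤ ‖x - a‖ ^ s * (‖y‖ / ‖x - a‖) ^ ρ := by
              rw [hφ _ hw]
              exact mul_le_mul_of_nonneg_left h1 (by positivity)
          _ = ‖x - a‖ ^ (s - ρ) * ‖y‖ ^ ρ := by
              rw [Real.div_rpow (norm_nonneg _) hw'.le, Real.rpow_sub hw']
              ring
          _ ≤ R ^ (s - ρ) * ‖y‖ ^ ρ :=
              mul_le_mul_of_nonneg_right (Real.rpow_le_rpow hw'.le hx (sub_nonneg.2 hρs))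
                (by positivity)
      linarith
    · have hxT : ‖x - a‖ ≤ T := by
        by_cases hw : x - a = 0
        · rw [hw, norm_zero]; exact hT0
        · have h3 : δ * ‖x - a‖ < ‖y‖ := not_le.1 fun h => hxy ⟨hw, h⟩
          rw [hT, inv_mul_eq_div, le_div_iff₀ hδ, mul_comm]
          exact h3.le
      have h1 : ‖cutoff φ a R (x + y)‖ ≤ R ^ (s - ρ) * T ^ ρ := by
        rw [cutoff]
        split_ifs with hin
        · refine hval _ hin ?_
          rw [add_sub_right_comm]
          exact (IsUltrametricDist.norm_add_le_max _ _).trans (max_le hxT hyT)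
        · rw [norm_zero]; exact hP2
      have h2 : ‖∑ m ∈ degLE S N, c m * φ (x - a) / mPow emb (x - a) m * mPow emb y m‖ ≤
          A * (R ^ (s - ρ) * T ^ ρ) := by
        refine (norm_sum_le _ _).trans ?_
        rw [hA, Finset.sum_mul]
        refine Finset.sum_le_sum fun m hm => ?_
        rw [mul_div_assoc, mul_assoc, norm_mul, norm_mul, norm_mPow hemb y]
        refine mul_le_mul_of_nonneg_left (le_trans ?_ (norm_mul_pow_div_le hemb hφ hφ0 hT0
          (le_trans (Nat.cast_le.2 (mem_degLE.1 hm)) hNρ) hρs hx hxT)) (norm_nonneg _)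
        exact mul_le_mul_of_nonneg_left (pow_le_pow_left₀ (norm_nonneg _) hyT _) (norm_nonneg _)
      have := norm_sub_le (cutoff φ a R (x + y))
        (∑ m ∈ degLE S N, c m * φ (x - a) / mPow emb (x - a) m * mPow emb y m)
      linarith
  · rw [if_neg hx, sub_zero, cutoff]
    split_ifs with hin
    · have hRy : R ≤ ‖y‖ := by
        by_contra! hlt
        refine hx ?_
        have : x - a = x + y - a - y := by ring
        rw [this]
        exact (norm_sub_le_max_norm _ _).trans (max_le hin hlt.le)
      have := hval _ hin (hin.trans (hRy.trans hyT))
      linarith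
    · rw [norm_zero]; linarith

/-- Uniform `C^r` bound for the cutoffs of a homogeneous function with Taylor expansions. -/
lemma exists_crBd_cutoff [IsUltrametricDist F] [CharZero E] {q : ℕ} (hq : 1 < q)
    (hemb : ∀ σ z, ‖emb σ z‖ = ‖z‖) {J : Set S} {d : S → ℕ} {r : ℝ} (hr : 0 ≤ r) (hrs : r < s)
    (hφ : ∀ w ≠ 0, ‖φ w‖ = ‖w‖ ^ s) (hφ0 : φ 0 = 0)
    {c : (S → ℕ) → E} (hc : ∀ m σ, σ ∉ J → d σ < m σ → c m = 0)
    {δ M : ℝ} (hδ : 0 < δ) (hδ1 : δ < 1) (hM : 0 ≤ M)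
    (hexp : ∀ w : F, w ≠ 0 → ∀ y : F, ‖y‖ ≤ δ * ‖w‖ →
      ‖φ (w + y) - ∑ m ∈ degLE S ⌊r⌋₊, c m * φ w / mPow emb w m * mPow emb y m‖ ≤
        M * ‖φ w‖ * (‖y‖ / ‖w‖) ^ (⌊r⌋₊ + 1)) :
    ∃ C : ℝ, 0 ≤ C ∧ ∀ (a : F) (R : ℝ), 0 < R → R ≤ 1 →
      CrBd q emb r J d (cutoff φ a R) (C * R ^ (s - r)) := by
  have hq1 : (1 : ℝ) < q := by exact_mod_cast hq
  have hq0 : (0 : ℝ) < q := by linarith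
  set A : ℝ := ∑ m ∈ degLE S ⌊r⌋₊, ‖c m‖ with hA
  have hA0 : 0 ≤ A := Finset.sum_nonneg fun _ _ => norm_nonneg _
  have hNr : (⌊r⌋₊ : ℝ) ≤ r := Nat.floor_le hr
  have hrN : r < (⌊r⌋₊ : ℝ) + 1 := Nat.lt_floor_add_one r
  have hδr : (1 : ℝ) ≤ (δ⁻¹) ^ r := Real.one_le_rpow ((one_lt_inv₀ hδ).2 hδ1).le hr
  refine ⟨M + (1 + A) * (δ⁻¹) ^ r, by positivity, fun a R hR hR1 => ?_⟩
  have hderiv : ∀ m : S → ℕ, mSum m ≤ ⌊r⌋₊ → ∀ x : F,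
      ‖cutoffDeriv emb c φ a R m x / (mFact m : E)‖ ≤ A * R ^ (s - r) := fun m hm x => by
    rw [cutoffDeriv_div, cutoff]
    split_ifs with hx
    · have h1 := norm_mul_pow_div_le (T := 1) (m := m) hemb hφ hφ0 zero_le_one
        (le_trans (Nat.cast_le.2 hm) hNr) hrs.le hx (hx.trans hR1)
      rw [one_pow, mul_one, Real.one_rpow, mul_one] at h1
      rw [mul_div_assoc, norm_mul]
      refine mul_le_mul ?_ h1 (norm_nonneg _) hA0
      exact Finset.single_le_sum (f := fun m => ‖c m‖) (fun _ _ => norm_nonneg _)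
        (mem_degLE.2 hm)
    · rw [norm_zero]; positivity
  refine ⟨cutoffDeriv emb c φ a R, ⟨fun m hm => ⟨A * R ^ (s - r) * ‖(mFact m : E)‖,
    fun x _ => ?_⟩, fun ε hε => ?_⟩, fun σ hσ x _ => ?_, fun m hm z _ => ?_, fun z y _ _ _ => ?_⟩
  · have := hderiv m hm x
    rwa [norm_div, div_le_iff₀ (norm_pos_iff.2 (mFact_cast_ne_zero m))] at this
  · obtain ⟨ρ, hrρ, hρs, hρN⟩ : ∃ ρ, r < ρ ∧ ρ ≤ s ∧ ρ ≤ (⌊r⌋₊ : ℝ) + 1 :=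
      ⟨min s (⌊r⌋₊ + 1), lt_min hrs hrN, min_le_left _ _, min_le_right _ _⟩
    set K : ℝ := (M + (1 + A) * (δ⁻¹) ^ ρ) * R ^ (s - ρ) with hK
    have hK0 : 0 ≤ K := by positivity
    have hlim : Tendsto (fun h : ℕ => K * ((q : ℝ) ^ (-(ρ - r))) ^ h) atTop (𝓝 (K * 0)) :=
      (tendsto_pow_atTop_nhds_zero_of_lt_one (by positivity)
        (Real.rpow_lt_one_of_one_lt_of_neg hq1 (by linarith))).const_mul K
    rw [mul_zero] at hlim
    obtain ⟨H, hH⟩ := eventually_atTop.1 (hlim.eventually (gt_mem_nhds hε))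
    refine ⟨H, fun h hh x y _ hy => le_trans ?_ (hH h hh).le⟩
    have h1 := norm_crRem_cutoff_le hemb hφ hφ0 hδ hδ1 hM hexp (hNr.trans hrρ.le) hρN hρs a hR.le
      x y
    have h2 : ‖y‖ ^ ρ ≤ (q : ℝ) ^ (-(h : ℝ) * ρ) := by
      refine (Real.rpow_le_rpow (norm_nonneg _) hy (hr.trans hrρ.le)).trans_eq ?_
      rw [← Real.rpow_intCast, ← Real.rpow_mul hq0.le]
      push_cast
      rfl
    calc _ ≤ K * (q : ℝ) ^ (-(h : ℝ) * ρ) * (q : ℝ) ^ (r * (h : ℝ)) :=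
          mul_le_mul_of_nonneg_right (h1.trans (mul_le_mul_of_nonneg_left h2 hK0)) (by positivity)
      _ = K * ((q : ℝ) ^ (-(ρ - r))) ^ h := by
          rw [mul_assoc, ← Real.rpow_add hq0, ← Real.rpow_mul_natCast hq0.le]
          congr 2
          ring
  · have hc0 : c (Pi.single σ (d σ + 1)) = 0 := hc _ σ hσ (by simp)
    rw [cutoffDeriv, cutoff, hc0]
    simp
  · refine (hderiv m hm z).trans (mul_le_mul_of_nonneg_right ?_ (by positivity))
    nlinarith
  · exact norm_crRem_cutoff_le hemb hφ hφ0 hδ hδ1 hM hexp hNr hrN.le hrs.le a hR.le z y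

end Cutoff

section Norms

lemma charZero_of_norm_natCast_lt_one {p : ℕ} (h0 : (p : E) ≠ 0) (h1 : ‖(p : E)‖ < 1) :
    CharZero E := by
  obtain ⟨l, hl⟩ := CharP.exists E
  rcases Nat.eq_zero_or_pos l with rfl | hpos
  · exact CharP.charP_to_charZero E
  · obtain ⟨a, b, hab, h⟩ := Finite.exists_ne_map_eq_of_infinite
      (fun k : ℕ => (⟨p ^ k % l, Nat.mod_lt _ hpos⟩ : Fin l))
    have h2 : ((p ^ a : ℕ) : E) = ((p ^ b : ℕ) : E) := by
      rw [CharP.cast_eq_mod E l (p ^ a), CharP.cast_eq_mod E l (p ^ b), Fin.mk.inj_iff.1 h]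
    rw [Nat.cast_pow, Nat.cast_pow] at h2
    have h3 := congrArg norm h2
    rw [norm_pow, norm_pow] at h3
    exact absurd (pow_right_injective₀ (norm_pos_iff.2 h0) h1.ne h3) hab

lemma norm_le_zpow_of_lt {q : ℕ} (hq : 1 < q)
    (hval : ∀ x : F, x ≠ 0 → ∃ n : ℤ, ‖x‖ = (q : ℝ) ^ n) {z : F} {n : ℤ}
    (h : ‖z‖ < (q : ℝ) ^ (n + 1)) : ‖z‖ ≤ (q : ℝ) ^ n := by
  have hq1 : (1 : ℝ) < q := by exact_mod_cast hq
  by_cases hz : z = 0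
  · rw [hz, norm_zero]; positivity
  obtain ⟨k, hk⟩ := hval z hz
  rw [hk] at h ⊢
  exact zpow_le_zpow_right₀ hq1.le (Int.lt_add_one_iff.1 ((zpow_lt_zpow_iff_right₀ hq1).1 h))

lemma norm_eq_of_norm_sub_lt [IsUltrametricDist F] {x y : F} (h : ‖x - y‖ < ‖y‖) :
    ‖x‖ = ‖y‖ := by
  have := IsUltrametricDist.norm_add_eq_max_of_norm_ne_norm h.ne
  rwa [sub_add_cancel, max_eq_right h.le] at this

lemma norm_inv_sub_le_iff [IsUltrametricDist F] {a z : F} (hz : z ≠ 0) {R : ℝ} (hR : 0 ≤ R)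
    (hRa : R < ‖a‖) : ‖z⁻¹ - a‖ ≤ R ↔ ‖z - a⁻¹‖ ≤ R / ‖a‖ ^ 2 := by
  have ha' : 0 < ‖a‖ := hR.trans_lt hRa
  have ha : a ≠ 0 := norm_pos_iff.1 ha'
  have hz' : 0 < ‖z‖ := norm_pos_iff.2 hz
  have key : z - a⁻¹ = -(z * (z⁻¹ - a) / a) := by
    field_simp
    ring
  have hn : ‖z - a⁻¹‖ = ‖z‖ * ‖z⁻¹ - a‖ / ‖a‖ := by rw [key, norm_neg, norm_div, norm_mul]
  constructor
  · intro h
    have h1 : ‖z‖⁻¹ = ‖a‖ := by rw [← norm_inv]; exact norm_eq_of_norm_sub_lt (h.trans_lt hRa)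
    rw [hn, ← h1, inv_pow, div_inv_eq_mul, div_inv_eq_mul]
    nlinarith [mul_le_mul_of_nonneg_right h (sq_nonneg ‖z‖)]
  · intro h
    have h1 : ‖z‖ = ‖a‖⁻¹ := by
      rw [← norm_inv]
      refine norm_eq_of_norm_sub_lt (h.trans_lt ?_)
      rw [norm_inv, div_lt_iff₀ (by positivity), sq, inv_mul_cancel_left₀ ha'.ne']
      exact hRa
    rw [hn, h1] at h
    have h2 : ‖a‖⁻¹ * ‖z⁻¹ - a‖ / ‖a‖ = ‖z⁻¹ - a‖ / ‖a‖ ^ 2 := by field_simp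
    rw [h2] at h
    exact (div_le_div_iff_of_pos_right (by positivity)).1 h

variable {emb : S → (F →+* E)} {J : Set S} {d : S → ℕ} {χ1 χ2 : F →* E} {r : ℝ}

lemma norm_phi (hemb : ∀ σ z, ‖emb σ z‖ = ‖z‖) (h1 : ∀ z ≠ 0, ‖χ1 z‖ = ‖z‖ ^ (-r))
    (h2 : ∀ z ≠ 0, ‖χ2 z‖ = ‖z‖ ^ (r - dSum J d)) {i : S → ℕ} (hi : ∀ σ, σ ∉ J → i σ ≤ d σ)
    {w : F} (hw : w ≠ 0) : ‖phi emb J d χ1 χ2 i w‖ = ‖w‖ ^ (2 * r - mSum i) := by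
  have hw' : 0 < ‖w‖ := norm_pos_iff.2 hw
  rw [phi, if_neg hw, norm_mul, norm_negPow hemb hi hw, chRatio, norm_div, h1 w hw, h2 w hw,
    ← Real.rpow_sub hw', ← Real.rpow_add hw']
  congr 1
  ring

lemma phi_zero (i : S → ℕ) : phi emb J d χ1 χ2 i 0 = 0 := if_pos rfl

lemma exists_crBd_cutoff_phi [IsUltrametricDist F] [IsUltrametricDist E] [CharZero E] {q : ℕ}
    (hq : 1 < q) (hemb : ∀ σ z, ‖emb σ z‖ = ‖z‖) (h1 : ∀ z ≠ 0, ‖χ1 z‖ = ‖z‖ ^ (-r))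
    (h2 : ∀ z ≠ 0, ‖χ2 z‖ = ‖z‖ ^ (r - dSum J d))
    (ht1 : HasTaylor emb J ⌊r⌋₊ (fun _ => 0) (fun t => χ1 (1 + t)))
    (ht2 : HasTaylor emb J ⌊r⌋₊ (fun _ => 0) (fun t => χ2 (1 + t))) :
    ∃ C : ℝ, 0 ≤ C ∧ ∀ i : S → ℕ, (∀ σ, σ ∉ J → i σ ≤ d σ) → (mSum i : ℝ) < r →
      ∀ (a : F) (R : ℝ), 0 < R → R ≤ 1 →
        CrBd q emb r J d (cutoff (phi emb J d χ1 χ2 i) a R) (C * R ^ (r - mSum i)) := by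
  have H : ∀ i : S → ℕ, ∃ C : ℝ, 0 ≤ C ∧ ((∀ σ, σ ∉ J → i σ ≤ d σ) → (mSum i : ℝ) < r →
      ∀ (a : F) (R : ℝ), 0 < R → R ≤ 1 →
        CrBd q emb r J d (cutoff (phi emb J d χ1 χ2 i) a R) (C * R ^ (r - mSum i))) := by
    intro i
    by_cases hi : (∀ σ, σ ∉ J → i σ ≤ d σ) ∧ (mSum i : ℝ) < r
    · obtain ⟨c, hc, δ, hδ, hδ1, M, hM, hexp⟩ := exists_phi_expansion (N := ⌊r⌋₊) (d := d) hemb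
        ht1 ht2 (fun u hu => by rw [h1 u (norm_pos_iff.1 (by rw [hu]; exact one_pos)), hu,
          Real.one_rpow]) i
      obtain ⟨C, hC0, hC⟩ := exists_crBd_cutoff (r := r) (s := 2 * r - mSum i) hq hemb
        ((Nat.cast_nonneg _).trans hi.2.le) (by linarith [hi.2])
        (fun w hw => norm_phi hemb h1 h2 hi.1 hw) (phi_zero i) hc hδ hδ1 hM hexp
      refine ⟨C, hC0, fun _ _ a R hR hR1 => ?_⟩
      have := hC a R hR hR1
      rwa [show 2 * r - mSum i - r = r - mSum i by ring] at this
    · exact ⟨0, le_rfl, fun h h' => absurd ⟨h, h'⟩ hi⟩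
  choose C hC0 hC using H
  refine ⟨∑ i ∈ degLE S ⌊r⌋₊, C i, Finset.sum_nonneg fun i _ => hC0 i,
    fun i hi hir a R hR hR1 => (hC i hi hir a R hR hR1).mono ?_⟩
  exact mul_le_mul_of_nonneg_right (Finset.single_le_sum (f := C) (fun i _ => hC0 i)
    (mem_degLE.2 (Nat.le_floor hir.le))) (by positivity)

end Norms

section Estimates

variable {q : ℕ} {emb : S → (F →+* E)} {J : Set S} {d : S → ℕ} {χ1 χ2 : F →* E} {r : ℝ}

lemma isCrJ_mPow_compl [IsUltrametricDist F] [CharZero E] (hq : 1 < q)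
    (hemb : ∀ σ z, ‖emb σ z‖ = ‖z‖) {i : S → ℕ} (hi : ∀ σ, σ ∉ J → i σ ≤ d σ)
    (hir : (mSum i : ℝ) ≤ r) {ρ : ℝ} (hρ : 0 < ρ) :
    IsCrJ q emb r J d (fun z => if ‖z‖ ≤ ρ then 0 else mPow emb z i) := by
  have hq1 : (1 : ℝ) < q := by exact_mod_cast hq
  have hq0 : (0 : ℝ) < q := by linarith
  set Df : (S → ℕ) → F → E := fun m x => if ‖x‖ ≤ ρ then 0 else
    mFact m * (mChoose i m * mPow emb x (fun σ => i σ - m σ)) with hDf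
  refine ⟨Df, ⟨fun m _ => ⟨‖(mFact m : E)‖ * ‖(mChoose i m : E)‖, fun x hx => ?_⟩,
    fun ε hε => ?_⟩, fun σ hσ x _ => ?_⟩
  · simp only [hDf]
    split_ifs
    · rw [norm_zero]; positivity
    · rw [norm_mul, norm_mul, norm_mPow hemb, ← mul_assoc]
      exact mul_le_of_le_one_right (by positivity) (pow_le_one₀ (norm_nonneg _) hx)
  · obtain ⟨H, hH⟩ := exists_pow_lt_of_lt_one hρ (inv_lt_one_of_one_lt₀ hq1)
    refine ⟨H, fun h hh x y _ hy => ?_⟩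
    have hyρ : ‖y‖ ≤ ρ := by
      refine hy.trans (le_trans ?_ hH.le)
      rw [zpow_neg, zpow_natCast, ← inv_pow]
      exact pow_le_pow_of_le_one (by positivity) (inv_le_one_of_one_le₀ hq1.le) hh
    have h0 : crRem emb ⌊r⌋₊ (fun z => if ‖z‖ ≤ ρ then 0 else mPow emb z i) Df x y = 0 := by
      rw [crRem]
      by_cases hx : ‖x‖ ≤ ρ
      · have hxy : ‖x + y‖ ≤ ρ := (IsUltrametricDist.norm_add_le_max x y).trans (max_le hx hyρ)
        simp [hDf, hx, hxy]
      · have hxy : ¬ ‖x + y‖ ≤ ρ := fun hxy => hx (by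
          simpa using (norm_sub_le_max_norm (x + y) y).trans (max_le hxy hyρ))
        simp only [hDf, hx, hxy, if_false]
        rw [mPow_add emb x y (Nat.le_floor hir), sub_eq_zero]
        refine Finset.sum_congr rfl fun m _ => ?_
        rw [mul_div_right_comm, mul_div_cancel_left₀ _ (mFact_cast_ne_zero m)]
    rw [h0, norm_zero, zero_mul]
    exact hε.le
  · have : mChoose i (Pi.single σ (d σ + 1)) = 0 :=
      mChoose_eq_zero (σ := σ) (by simpa using Nat.lt_succ_of_le (hi σ hσ))
    simp [hDf, this]

lemma extProp_mPow_compl (hq : 1 < q)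
    (hval : ∀ x : F, x ≠ 0 → ∃ n : ℤ, ‖x‖ = (q : ℝ) ^ n)
    {i : S → ℕ} (hi : ∀ σ, σ ∉ J → i σ ≤ d σ) (n : ℤ) :
    ExtProp emb J d χ1 χ2
      (fun z => if ‖z‖ ≤ (q : ℝ) ^ (-(n + 1)) then 0 else mPow emb z i)
      (cutoff (phi emb J d χ1 χ2 i) 0 ((q : ℝ) ^ n)) := by
  intro z hz _
  have hq1 : (1 : ℝ) < q := by exact_mod_cast hq
  have hq0 : (0 : ℝ) < q := by linarith
  have hz' : 0 < ‖z‖ := norm_pos_iff.2 hz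
  have hiff : ‖z⁻¹‖ ≤ (q : ℝ) ^ (-(n + 1)) ↔ ¬ ‖z‖ ≤ (q : ℝ) ^ n := by
    rw [norm_inv, zpow_neg, inv_le_inv₀ hz' (by positivity)]
    constructor
    · intro h h'
      exact absurd (h.trans h') (not_le.2 (zpow_lt_zpow_right₀ hq1 (lt_add_one n)))
    · intro h
      by_contra h'
      exact h (norm_le_zpow_of_lt hq hval (not_le.1 h'))
  simp only [cutoff, sub_zero, hiff]
  by_cases h : ‖z‖ ≤ (q : ℝ) ^ n
  · rw [if_pos h, if_neg (not_not.2 h), ← phi_mul_mPow_self hi hz, mPow_inv,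
      mul_inv_cancel_right₀ (mPow_ne_zero emb hz i)]
  · rw [if_neg h, if_pos h, mul_zero]

lemma cutoff_phi_mul {ϖ : F} (hq : 1 < q) (hϖ : ‖ϖ‖ = (q : ℝ)⁻¹) (i : S → ℕ) (a : F) (R : ℝ) (z : F) :
    cutoff (phi emb J d χ1 χ2 i) a R (ϖ * z) =
      phi emb J d χ1 χ2 i ϖ * cutoff (phi emb J d χ1 χ2 i) (ϖ⁻¹ * a) (q * R) z := by
  have hq0 : (0 : ℝ) < q := by positivity
  have hϖ0 : ϖ ≠ 0 := norm_pos_iff.1 (by rw [hϖ]; positivity)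
  have h : ϖ * z - a = ϖ * (z - ϖ⁻¹ * a) := by
    rw [mul_sub, mul_inv_cancel_left₀ hϖ0]
  have hiff : ‖ϖ * z - a‖ ≤ R ↔ ‖z - ϖ⁻¹ * a‖ ≤ q * R := by
    rw [h, norm_mul, hϖ, inv_mul_le_iff₀ hq0]
  simp only [cutoff, hiff]
  rw [h, phi_mul]
  split_ifs
  · rfl
  · rw [mul_zero]

variable [IsUltrametricDist F] [IsUltrametricDist E] [CharZero E] {ϖ : F} {C : ℝ}

omit [IsUltrametricDist E] in
lemma memB_mPow_compl (hq : 1 < q) (hϖ : ‖ϖ‖ = (q : ℝ)⁻¹)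
    (hval : ∀ x : F, x ≠ 0 → ∃ n : ℤ, ‖x‖ = (q : ℝ) ^ n) (hemb : ∀ σ z, ‖emb σ z‖ = ‖z‖)
    (hE : ∃ t : E, 1 < ‖t‖) (hC0 : 0 ≤ C) {i : S → ℕ} (hi : ∀ σ, σ ∉ J → i σ ≤ d σ)
    (hir : (mSum i : ℝ) < r)
    (hC : ∀ (a : F) (R : ℝ), 0 < R → R ≤ 1 →
      CrBd q emb r J d (cutoff (phi emb J d χ1 χ2 i) a R) (C * R ^ (r - mSum i)))
    {n : ℤ} (hn : n ≤ 0) :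
    MemB q emb r J d χ1 χ2
      (fun z : F => if ‖z‖ ≤ (q : ℝ) ^ (-(n + 1)) then 0 else mPow emb z i) ∧
    BNorm q emb r J d χ1 χ2 ϖ
      (fun z : F => if ‖z‖ ≤ (q : ℝ) ^ (-(n + 1)) then 0 else mPow emb z i) ≤
      C * (q : ℝ) ^ ((n : ℝ) * (r - (mSum i : ℝ))) := by
  have hq1 : (1 : ℝ) < q := by exact_mod_cast hq
  have hq0 : (0 : ℝ) < q := by linarith
  have hext := extProp_mPow_compl (χ1 := χ1) (χ2 := χ2) (emb := emb) hq hval hi n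
  have hg := hC 0 _ (zpow_pos hq0 n) (zpow_le_one_of_nonpos₀ hq1.le hn)
  rw [← Real.rpow_intCast, ← Real.rpow_mul hq0.le, Real.rpow_intCast] at hg
  refine ⟨⟨isCrJ_mPow_compl hq hemb hi hir.le (by positivity), _, hg.isCrJ, hext⟩,
    BNorm_le hq ((Nat.cast_nonneg _).trans hir.le) hϖ hval hemb hE (by positivity)
      ((CrBd.zero (by positivity)).congr hq fun z hz => if_pos ?_) hg hext⟩
  rw [norm_mul, hϖ]
  refine (mul_le_of_le_one_right (by positivity) hz).trans ?_
  rw [← zpow_neg_one]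
  exact zpow_le_zpow_right₀ hq1.le (by omega)

/-- The second chart of a cutoff of `phi` around a point outside the open unit ball. -/
lemma exists_extProp_cutoff (hemb : ∀ σ z, ‖emb σ z‖ = ‖z‖)
    (h1 : ∀ z ≠ 0, ‖χ1 z‖ = ‖z‖ ^ (-r)) (h2 : ∀ z ≠ 0, ‖χ2 z‖ = ‖z‖ ^ (r - dSum J d))
    (hC0 : 0 ≤ C)
    (hC : ∀ i : S → ℕ, (∀ σ, σ ∉ J → i σ ≤ d σ) → (mSum i : ℝ) < r →
      ∀ (a : F) (R : ℝ), 0 < R → R ≤ 1 →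
        CrBd q emb r J d (cutoff (phi emb J d χ1 χ2 i) a R) (C * R ^ (r - mSum i)))
    {i : S → ℕ} (hi : ∀ σ, σ ∉ J → i σ ≤ d σ) (hir : (mSum i : ℝ) < r)
    (a : F) {R : ℝ} (hR : 0 < R) (hR1 : R < 1) :
    ∃ g : F → E, CrBd q emb r J d g (C * R ^ (r - mSum i)) ∧
      ExtProp emb J d χ1 χ2 (cutoff (phi emb J d χ1 χ2 i) a R) g := by
  have hB : 0 ≤ C * R ^ (r - mSum i) := by positivity
  by_cases ha : ‖a‖ < 1
  · refine ⟨fun _ => 0, CrBd.zero hB, fun z hz hz1 => ?_⟩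
    have hz' : 0 < ‖z‖ := norm_pos_iff.2 hz
    have h3 : 1 ≤ ‖z⁻¹‖ := by rw [norm_inv]; exact (one_le_inv₀ hz').2 hz1
    have h4 : ¬ ‖z⁻¹ - a‖ ≤ R := fun h => by
      have h5 : ‖z⁻¹ - a + a‖ < 1 :=
        (IsUltrametricDist.norm_add_le_max _ _).trans_lt (max_lt (h.trans_lt hR1) ha)
      rw [sub_add_cancel] at h5
      linarith
    rw [cutoff, if_neg h4, mul_zero]
  push Not at ha
  have ha' : 0 < ‖a‖ := one_pos.trans_le ha
  have ha0 : a ≠ 0 := norm_pos_iff.1 ha'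
  have hR' : 0 < R / ‖a‖ ^ 2 := by positivity
  have hR1' : R / ‖a‖ ^ 2 ≤ 1 := (div_le_one (by positivity)).2 (hR1.le.trans (one_le_pow₀ ha))
  refine ⟨fun z => ∑ j ∈ degLE S (mSum i), if ∀ σ, j σ ≤ i σ then
    mChoose i j * mPow emb a⁻¹ (fun σ => i σ - j σ) * phi emb J d χ1 χ2 i (-a) *
      cutoff (phi emb J d χ1 χ2 (fun σ => i σ - j σ)) a⁻¹ (R / ‖a‖ ^ 2) z else 0,
    CrBd.sum _ hB fun j _ => ?_, fun z hz hz1 => ?_⟩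
  · by_cases hj : ∀ σ, j σ ≤ i σ
    swap
    · simpa only [if_neg hj] using CrBd.zero hB
    simp only [if_pos hj]
    set k : S → ℕ := fun σ => i σ - j σ with hk
    have hki : (mSum k : ℝ) ≤ mSum i := Nat.cast_le.2 (mSum_mono fun σ => Nat.sub_le _ _)
    refine ((hC k (fun σ hσ => (Nat.sub_le _ _).trans (hi σ hσ)) (hki.trans_lt hir) a⁻¹ _ hR'
      hR1').const_mul _).mono ?_
    rw [norm_mul, norm_mul, norm_mPow hemb, norm_phi hemb h1 h2 hi (neg_ne_zero.2 ha0), norm_neg,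
      norm_inv]
    have hch : ‖(mChoose i j : E)‖ ≤ 1 := IsUltrametricDist.norm_natCast_le_one E _
    have hcalc : (‖a‖⁻¹) ^ mSum k * ‖a‖ ^ (2 * r - mSum i) * (R / ‖a‖ ^ 2) ^ (r - mSum k) =
        ‖a‖ ^ ((mSum k : ℝ) - mSum i) * R ^ (r - mSum k) := by
      rw [Real.div_rpow hR.le (by positivity), ← Real.rpow_natCast ‖a‖ 2, ← Real.rpow_mul ha'.le,
        ← Real.rpow_natCast, Real.inv_rpow ha'.le, ← Real.rpow_neg ha'.le, ← Real.rpow_add ha',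
        ← mul_div_assoc, mul_div_right_comm, ← Real.rpow_sub ha']
      congr 2
      push_cast
      ring
    calc _ = ‖(mChoose i j : E)‖ * C * ((‖a‖⁻¹) ^ mSum k * ‖a‖ ^ (2 * r - mSum i) *
          (R / ‖a‖ ^ 2) ^ (r - mSum k)) := by ring
      _ ≤ 1 * C * (1 * R ^ (r - mSum i)) := by
        rw [hcalc]
        have h3 : ‖a‖ ^ ((mSum k : ℝ) - mSum i) ≤ 1 :=
          Real.rpow_le_one_of_one_le_of_nonpos ha (by linarith)
        have h4 : R ^ (r - mSum k) ≤ R ^ (r - mSum i) :=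
          Real.rpow_le_rpow_of_exponent_ge hR hR1.le (by linarith)
        gcongr
      _ = _ := by ring
  · have hiff := norm_inv_sub_le_iff (a := a) hz hR.le (hR1.trans_le ha)
    simp only [cutoff, hiff]
    by_cases h : ‖z - a⁻¹‖ ≤ R / ‖a‖ ^ 2
    swap
    · simp [h]
    simp only [if_pos h]
    have hfac : (z⁻¹ - a) * z = -a * (z - a⁻¹) := by
      field_simp
      ring
    have h3 : phi emb J d χ1 χ2 i (z⁻¹ - a) * phi emb J d χ1 χ2 i z =
        phi emb J d χ1 χ2 i (-a) * phi emb J d χ1 χ2 i (z - a⁻¹) := by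
      rw [← phi_mul, ← phi_mul, hfac]
    have h4 : mPow emb z i = ∑ j ∈ degLE S (mSum i),
        (mChoose i j : E) * mPow emb a⁻¹ (fun σ => i σ - j σ) * mPow emb (z - a⁻¹) j := by
      rw [← mPow_add emb _ _ le_rfl, add_sub_cancel]
    rw [← phi_mul_mPow_self hi hz, mul_right_comm, mul_comm (phi emb J d χ1 χ2 i z), h3, h4,
      Finset.mul_sum]
    refine Finset.sum_congr rfl fun j _ => ?_
    by_cases hj : ∀ σ, j σ ≤ i σ
    · rw [if_pos hj, ← phi_mul_mPow hi hj]
      ring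
    · rw [if_neg hj]
      obtain ⟨σ, hσ⟩ := not_forall.1 hj
      rw [mChoose_eq_zero (not_le.1 hσ)]
      simp

lemma memB_cutoff (hq : 1 < q) (hϖ : ‖ϖ‖ = (q : ℝ)⁻¹)
    (hval : ∀ x : F, x ≠ 0 → ∃ n : ℤ, ‖x‖ = (q : ℝ) ^ n) (hemb : ∀ σ z, ‖emb σ z‖ = ‖z‖)
    (hE : ∃ t : E, 1 < ‖t‖)
    (h1 : ∀ z ≠ 0, ‖χ1 z‖ = ‖z‖ ^ (-r)) (h2 : ∀ z ≠ 0, ‖χ2 z‖ = ‖z‖ ^ (r - dSum J d))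
    (hC0 : 0 ≤ C)
    (hC : ∀ i : S → ℕ, (∀ σ, σ ∉ J → i σ ≤ d σ) → (mSum i : ℝ) < r →
      ∀ (a : F) (R : ℝ), 0 < R → R ≤ 1 →
        CrBd q emb r J d (cutoff (phi emb J d χ1 χ2 i) a R) (C * R ^ (r - mSum i)))
    {i : S → ℕ} (hi : ∀ σ, σ ∉ J → i σ ≤ d σ) (hir : (mSum i : ℝ) < r)
    (a : F) {n : ℤ} (hn : 1 ≤ n) :
    MemB q emb r J d χ1 χ2 (cutoff (phi emb J d χ1 χ2 i) a ((q : ℝ) ^ (-n))) ∧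
    BNorm q emb r J d χ1 χ2 ϖ (cutoff (phi emb J d χ1 χ2 i) a ((q : ℝ) ^ (-n))) ≤
      C * (q : ℝ) ^ ((n : ℝ) * ((mSum i : ℝ) - r)) := by
  have hq1 : (1 : ℝ) < q := by exact_mod_cast hq
  have hq0 : (0 : ℝ) < q := by linarith
  have hr : 0 ≤ r := (Nat.cast_nonneg _).trans hir.le
  have hϖ0 : ϖ ≠ 0 := norm_pos_iff.1 (by rw [hϖ]; positivity)
  have hpow : (q : ℝ) ^ ((n : ℝ) * ((mSum i : ℝ) - r)) = ((q : ℝ) ^ (-n)) ^ (r - mSum i) := by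
    rw [← Real.rpow_intCast, ← Real.rpow_mul hq0.le]
    push_cast
    congr 1
    ring
  rw [hpow]
  set R : ℝ := (q : ℝ) ^ (-n) with hRdef
  have hR : 0 < R := zpow_pos hq0 _
  have hR1 : R < 1 := zpow_lt_one_of_neg₀ hq1 (by omega)
  have hqR : q * R ≤ 1 := by
    rw [hRdef, ← zpow_one_add₀ hq0.ne']
    exact zpow_le_one_of_nonpos₀ hq1.le (by omega)
  obtain ⟨g, hg, hext⟩ := exists_extProp_cutoff hemb h1 h2 hC0 hC hi hir a hR hR1
  refine ⟨⟨(hC i hi hir a R hR hR1.le).isCrJ, g, hg.isCrJ, hext⟩,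
    BNorm_le hq hr hϖ hval hemb hE (by positivity) ?_ hg hext⟩
  simp only [cutoff_phi_mul hq hϖ]
  refine ((hC i hi hir _ _ (mul_pos hq0 hR) hqR).const_mul _).mono ?_
  rw [norm_phi hemb h1 h2 hi hϖ0, hϖ, Real.mul_rpow hq0.le hR.le, Real.inv_rpow hq0.le,
    ← Real.rpow_neg hq0.le]
  calc _ = C * R ^ (r - mSum i) * ((q : ℝ) ^ (-(2 * r - mSum i)) * (q : ℝ) ^ (r - mSum i)) := by
        ring
    _ = C * R ^ (r - mSum i) * (q : ℝ) ^ (-r) := by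
        rw [← Real.rpow_add hq0]
        congr 2
        ring
    _ ≤ C * R ^ (r - mSum i) :=
        mul_le_of_le_one_right (by positivity)
          (Real.rpow_le_one_of_one_le_of_nonpos hq1.le (by linarith))

end Estimates

/-- Lemme "lemmafinale1": under the standing hypotheses:
(a) there is C ≥ 0 such that for all n ≤ 0 and all (k,m) with r - (|k|+|m|) > 0, the
function 1_{F∖D(0,n+1)}(z) z^k z^m lies in B(χ,J,d) with
‖1_{F∖D(0,n+1)}(z) z^k z^m‖_B ≤ C q^{n(r-|k|-|m|)};
(b) there is C ≥ 0 such that for all a ∈ F, n ≥ 1 and all (k,m) with r - (|k|+|m|) > 0,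
the function 1_{D(a,n)}(z) χ2χ1⁻¹(z-a)(z-a)^{d-k}(z-a)^{-m} lies in B(χ,J,d) with
B-norm at most C q^{n(|k|+|m|-r)}. -/
theorem statement17
    {p q e f0 : ℕ} (hp : 1 < p) (hf0 : 0 < f0) (he : 0 < e) (hq : q = p ^ f0)
    {F E : Type*} [NormedField F] [NormedField E]
    [IsUltrametricDist F] [IsUltrametricDist E]
    [CompleteSpace F] [CompleteSpace E]
    (ϖ : F) (hϖ : ‖ϖ‖ = (q : ℝ)⁻¹)
    (hval : ∀ x : F, x ≠ 0 → ∃ n : ℤ, ‖x‖ = (q : ℝ) ^ n)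
    (hres : ∀ (a : F) (n : ℤ), ∃ R : Finset F, R.card = q ∧
      (∀ x ∈ R, ‖x - a‖ ≤ (q : ℝ) ^ (-n)) ∧
      ∀ z : F, ‖z - a‖ ≤ (q : ℝ) ^ (-n) → ∃! x, x ∈ R ∧ ‖z - x‖ ≤ (q : ℝ) ^ (-(n + 1)))
    (hpF : ‖(p : F)‖ = (q : ℝ) ^ (-(e : ℤ)))
    (hpE : ‖(p : E)‖ = (p : ℝ) ^ (-((e * f0 : ℕ) : ℤ)))
    {S : Type*} [Fintype S] (emb : S → (F →+* E))
    (hemb : ∀ (σ : S) (z : F), ‖emb σ z‖ = ‖z‖)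
    (J : Set S) (d : S → ℕ) (χ1 χ2 : F →* E)
    (hχ1 : IsLocJChar q emb J χ1) (hχ2 : IsLocJChar q emb J χ2)
    (hχ1ne : ∀ z : F, z ≠ 0 → χ1 z ≠ 0) (hχ2ne : ∀ z : F, z ≠ 0 → χ2 z ≠ 0)
    (r : ℝ) (hrdef : r = -vP p (e * f0) (χ1 (p : F)))
    (hcentral : vP p (e * f0) (χ1 (p : F)) + vP p (e * f0) (χ2 (p : F))
      + (dSum J d : ℝ) = 0)
    (hpos : 0 ≤ vP p (e * f0) (χ2 (p : F)) + (dSum J d : ℝ))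
    (hd : ∀ σ, σ ∉ J → (d σ : ℝ) + 1 ≤ r) :
    (∃ C : ℝ, 0 ≤ C ∧ ∀ (n : ℤ) (i : S → ℕ), n ≤ 0 → (∀ σ, σ ∉ J → i σ ≤ d σ) →
      (mSum i : ℝ) < r →
      MemB q emb r J d χ1 χ2
        (fun z : F => if ‖z‖ ≤ (q : ℝ) ^ (-(n + 1)) then 0 else mPow emb z i) ∧
      BNorm q emb r J d χ1 χ2 ϖ
        (fun z : F => if ‖z‖ ≤ (q : ℝ) ^ (-(n + 1)) then 0 else mPow emb z i) ≤
        C * (q : ℝ) ^ ((n : ℝ) * (r - (mSum i : ℝ)))) ∧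
    (∃ C : ℝ, 0 ≤ C ∧ ∀ (a : F) (n : ℤ) (i : S → ℕ), 1 ≤ n →
      (∀ σ, σ ∉ J → i σ ≤ d σ) → (mSum i : ℝ) < r →
      MemB q emb r J d χ1 χ2
        (fun z : F => if ‖z - a‖ ≤ (q : ℝ) ^ (-n) then lFun2 emb J d χ1 χ2 a i z
          else 0) ∧
      BNorm q emb r J d χ1 χ2 ϖ
        (fun z : F => if ‖z - a‖ ≤ (q : ℝ) ^ (-n) then lFun2 emb J d χ1 χ2 a i z
          else 0) ≤
        C * (q : ℝ) ^ ((n : ℝ) * ((mSum i : ℝ) - r))) := by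
  have hp0 : (1 : ℝ) < p := by exact_mod_cast hp
  have hq1 : 1 < q := by rw [hq]; exact Nat.one_lt_pow hf0.ne' hp
  have hpF0 : (p : F) ≠ 0 := norm_pos_iff.1 (by rw [hpF]; positivity)
  have hpE0 : (p : E) ≠ 0 := norm_pos_iff.1 (by rw [hpE]; positivity)
  have hpE1 : ‖(p : E)‖ < 1 := by
    rw [hpE]
    exact zpow_lt_one_of_neg₀ hp0 (neg_lt_zero.2 (by exact_mod_cast Nat.mul_pos he hf0))
  have : CharZero E := charZero_of_norm_natCast_lt_one hpE0 hpE1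
  have hE : ∃ t : E, 1 < ‖t‖ :=
    ⟨(p : E)⁻¹, by rw [norm_inv]; exact (one_lt_inv₀ (norm_pos_iff.2 hpE0)).2 hpE1⟩
  have h1 : ∀ z : F, z ≠ 0 → ‖χ1 z‖ = ‖z‖ ^ (-r) := fun z hz => by
    rw [hrdef, neg_neg]
    exact norm_char hq1 he hval hres hpF hχ1.1
      (norm_eq_rpow_vP hp hf0 he hq hpF (hχ1ne _ hpF0)) hz
  have h2 : ∀ z : F, z ≠ 0 → ‖χ2 z‖ = ‖z‖ ^ (r - dSum J d) := fun z hz => by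
    rw [show r - dSum J d = vP p (e * f0) (χ2 (p : F)) by linarith]
    exact norm_char hq1 he hval hres hpF hχ2.1
      (norm_eq_rpow_vP hp hf0 he hq hpF (hχ2ne _ hpF0)) hz
  obtain ⟨C, hC0, hC⟩ := exists_crBd_cutoff_phi (r := r) (d := d) hq1 hemb h1 h2
    (hasTaylor_char hq1 hϖ hemb _ hχ1) (hasTaylor_char hq1 hϖ hemb _ hχ2)
  refine ⟨⟨C, hC0, fun n i hn hi hir =>
    memB_mPow_compl hq1 hϖ hval hemb hE hC0 hi hir (hC i hi hir) hn⟩,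
    ⟨C, hC0, fun a n i hn hi hir => ?_⟩⟩
  have hcut : (fun z : F => if ‖z - a‖ ≤ (q : ℝ) ^ (-n) then lFun2 emb J d χ1 χ2 a i z else 0) =
      cutoff (phi emb J d χ1 χ2 i) a ((q : ℝ) ^ (-n)) := by
    funext z
    rw [cutoff, lFun2_eq_phi]
  rw [hcut]
  exact memB_cutoff hq1 hϖ hval hemb hE h1 h2 hC0 hC hi hir a hn
end Paper
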